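/- arXiv:2404.00624 — 2 statements merged into one kernel-verified Lean document; each statement's English description precedes it below -/
import Mathlib

section
/- If N is a friend of 10, then N has at least 7 distinct prime factors, i.e. ω(N) ≥ 7. -/
open Finset

theorem div_sub_one_anti {a b : ℕ} (ha : 2 ≤ a) (hab : a ≤ b) :
    (b : ℚ) / (b - 1) ≤ a / (a - 1) := by
  have ha' : (2 : ℚ) ≤ a := by exact_mod_cast ha
  have hab' : (a : ℚ) ≤ b := by exact_mod_cast hab
  rw [div_le_div_iff₀ (by linarith) (by linarith)]
  linarith

/-- Over a finite set of integers, `∏ p / (p - 1)` does not decrease when the elements outside `K`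
are replaced by the at least as many, and smaller, elements of `B`. -/
theorem prod_div_sub_one_le {S K B : Finset ℕ} (hKS : K ⊆ S) (hcard : S.card ≤ K.card + B.card)
    (hS : ∀ p ∈ S, 2 ≤ p) (hB : ∀ p ∈ B, 2 ≤ p)
    (h : ∀ p ∈ S, p ∉ K → p ∉ B → ∀ b ∈ B, b ≤ p) :
    ∏ p ∈ S, (p : ℚ) / (p - 1) ≤
      (∏ p ∈ K, (p : ℚ) / (p - 1)) * ∏ p ∈ B, (p : ℚ) / (p - 1) := by
  have one_le {a : ℕ} (ha : 2 ≤ a) : (1 : ℚ) ≤ a / (a - 1) := by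
    have ha' : (2 : ℚ) ≤ a := by exact_mod_cast ha
    rw [le_div_iff₀ (by linarith)]
    linarith
  have nonneg {T : Finset ℕ} (hT : ∀ p ∈ T, 2 ≤ p) : 0 ≤ ∏ p ∈ T, (p : ℚ) / (p - 1) :=
    prod_nonneg fun p hp => zero_le_one.trans (one_le (hT p hp))
  rw [← prod_sdiff hKS, mul_comm]
  refine mul_le_mul_of_nonneg_left ?_ (nonneg fun p hp => hS p (hKS hp))
  have hA : ∀ p ∈ S \ K, 2 ≤ p := fun p hp => hS p (mem_sdiff.1 hp).1
  set A := S \ K with hAdef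
  have hAB : A.card ≤ B.card := by
    have := card_sdiff_add_card_eq_card hKS
    rw [← hAdef] at this
    omega
  rw [← prod_sdiff (inter_subset_left : A ∩ B ⊆ A), ← prod_sdiff (inter_subset_right : A ∩ B ⊆ B)]
  refine mul_le_mul_of_nonneg_right ?_ (nonneg fun p hp => hA p (mem_inter.1 hp).1)
  rcases (B \ (A ∩ B)).eq_empty_or_nonempty with hE | hne
  · have h1 := card_sdiff_add_card_eq_card (inter_subset_left : A ∩ B ⊆ A)
    have h2 := card_sdiff_add_card_eq_card (inter_subset_right : A ∩ B ⊆ B)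
    rw [hE, card_empty] at h2
    have h3 : A \ (A ∩ B) = ∅ := card_eq_zero.1 (by omega)
    simp [hE, h3]
  · obtain ⟨m, hm, hmax⟩ := exists_max_image (B \ (A ∩ B)) id hne
    have hm2 : 2 ≤ m := hB m (mem_sdiff.1 hm).1
    have h1 := card_sdiff_add_card_eq_card (inter_subset_left : A ∩ B ⊆ A)
    have h2 := card_sdiff_add_card_eq_card (inter_subset_right : A ∩ B ⊆ B)
    calc ∏ p ∈ A \ (A ∩ B), (p : ℚ) / (p - 1)
        ≤ ∏ _p ∈ A \ (A ∩ B), (m : ℚ) / (m - 1) := by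
          refine prod_le_prod (fun p hp => zero_le_one.trans (one_le (hA p (mem_sdiff.1 hp).1)))
            fun p hp => div_sub_one_anti hm2 ?_
          simp only [hAdef, mem_sdiff, mem_inter, not_and] at hp hm
          exact h p hp.1.1 hp.1.2 (hp.2 hp.1) m hm.1
      _ = ((m : ℚ) / (m - 1)) ^ (A \ (A ∩ B)).card := prod_const _
      _ ≤ ((m : ℚ) / (m - 1)) ^ (B \ (A ∩ B)).card := pow_le_pow_right₀ (one_le hm2) (by omega)
      _ = ∏ _p ∈ B \ (A ∩ B), (m : ℚ) / (m - 1) := (prod_const _).symm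
      _ ≤ ∏ p ∈ B \ (A ∩ B), (p : ℚ) / (p - 1) :=
          prod_le_prod (fun p hp => zero_le_one.trans (one_le hm2))
            fun p hp => div_sub_one_anti (hB p (mem_sdiff.1 hp).1) (hmax p hp)

theorem sum_range_pow_dvd_sum_range_pow {a b : ℕ} (h : a ∣ b) (x : ℕ) :
    ∑ i ∈ range a, x ^ i ∣ ∑ i ∈ range b, x ^ i := by
  obtain ⟨k, rfl⟩ := h
  induction k with
  | zero => simp
  | succ k ih =>
    rw [Nat.mul_succ, sum_range_add]
    refine dvd_add ih ?_
    simp only [pow_add, ← mul_sum]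
    exact dvd_mul_left _ _

theorem sum_range_mul_pow (a b x : ℕ) :
    ∑ i ∈ range (a * b), x ^ i = (∑ i ∈ range a, x ^ i) * ∑ i ∈ range b, (x ^ a) ^ i := by
  induction b with
  | zero => simp
  | succ b ih =>
    rw [Nat.mul_succ, sum_range_add, ih, sum_range_succ _ b, mul_add]
    simp only [pow_add, ← mul_sum, pow_mul]
    ring

/-- A prime dividing `1 + x + ⋯ + x ^ (m - 1)`, with `m` coprime to `p - 1`, divides both `x - 1`
and `m`. -/
theorem modEq_one_of_dvd_sum_range_pow {p m x : ℕ} (hp : p.Prime) (hm0 : m ≠ 0)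
    (hm : m.Coprime (p - 1))
    (h : p ∣ ∑ i ∈ range m, x ^ i) : x ≡ 1 [MOD p] ∧ p ∣ m := by
  have := Fact.mk hp
  have hz : ∑ i ∈ range m, (x : ZMod p) ^ i = 0 := by
    have := (ZMod.natCast_eq_zero_iff _ _).2 h
    exact_mod_cast this
  have hx : (x : ZMod p) ^ m = 1 := by
    have := mul_geom_sum (x : ZMod p) m
    rw [hz, mul_zero] at this
    exact (sub_eq_zero.1 this.symm)
  have hx1 : (x : ZMod p) = 1 := by
    by_cases hx0 : (x : ZMod p) = 0
    · rw [hx0, zero_pow hm0] at hx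
      exact absurd hx zero_ne_one
    · have h1 := orderOf_dvd_of_pow_eq_one hx
      have h2 := orderOf_dvd_of_pow_eq_one (ZMod.pow_card_sub_one_eq_one hx0)
      have := Nat.dvd_gcd h1 h2
      rw [hm] at this
      exact orderOf_eq_one_iff.1 (Nat.dvd_one.1 this)
  constructor
  · rw [← ZMod.natCast_eq_natCast_iff]
    simpa using hx1
  · rw [hx1] at hz
    simp at hz
    exact (ZMod.natCast_eq_zero_iff _ _).1 hz

/-- A prime dividing the value at `x` of the `l ^ (k + 1)`-th cyclotomic polynomial is `l` or is
`1` modulo `l ^ (k + 1)`. -/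
theorem eq_or_modEq_one_of_dvd_sum_range_pow {p l k x : ℕ} (hp : p.Prime) (hl : l.Prime)
    (h : p ∣ ∑ i ∈ range l, (x ^ l ^ k) ^ i) : p = l ∨ l ^ (k + 1) ∣ p - 1 := by
  have := Fact.mk hp
  have := Fact.mk hl
  have hz : ∑ i ∈ range l, ((x : ZMod p) ^ l ^ k) ^ i = 0 := by
    have := (ZMod.natCast_eq_zero_iff _ _).2 h
    exact_mod_cast this
  have hx : (x : ZMod p) ^ l ^ (k + 1) = 1 := by
    have := mul_geom_sum ((x : ZMod p) ^ l ^ k) l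
    rw [hz, mul_zero] at this
    rw [pow_succ, pow_mul]
    exact (sub_eq_zero.1 this.symm)
  by_cases hx1 : (x : ZMod p) ^ l ^ k = 1
  · left
    rw [hx1] at hz
    simp at hz
    exact (Nat.prime_dvd_prime_iff_eq hp hl).1 ((ZMod.natCast_eq_zero_iff _ _).1 hz)
  · right
    have hx0 : (x : ZMod p) ≠ 0 := by
      intro h0
      rw [h0, zero_pow (pow_ne_zero _ hl.ne_zero)] at hx
      exact zero_ne_one hx
    rw [← orderOf_eq_prime_pow hx1 hx]
    exact orderOf_dvd_of_pow_eq_one (ZMod.pow_card_sub_one_eq_one hx0)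

theorem sq_dvd_prod {p : ℕ} (hp : p.Prime) {S : Finset ℕ} {g : ℕ → ℕ}
    (h : p ^ 2 ∣ ∏ i ∈ S, g i) :
    (∃ i ∈ S, p ^ 2 ∣ g i) ∨ ∃ i ∈ S, ∃ j ∈ S, i ≠ j ∧ p ∣ g i ∧ p ∣ g j := by
  obtain ⟨i, hi, hpi⟩ := hp.prime.exists_mem_finset_dvd ((dvd_pow_self p two_ne_zero).trans h)
  rw [← mul_prod_erase _ _ hi] at h
  by_cases hd : p ∣ ∏ j ∈ S.erase i, g j
  · obtain ⟨j, hj, hpj⟩ := hp.prime.exists_mem_finset_dvd hd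
    exact Or.inr ⟨i, hi, j, mem_of_mem_erase hj, (ne_of_mem_erase hj).symm, hpi, hpj⟩
  · exact Or.inl ⟨i, hi, ((hp.coprime_iff_not_dvd.2 hd).pow_left 2).dvd_of_dvd_mul_right h⟩

theorem dvd_prod_pow_of_primeFactors_subset {n m : ℕ} {P : Finset ℕ} (hn : n ≠ 0)
    (h : n.primeFactors ⊆ P) (hm : n < 2 ^ m) : n ∣ (∏ p ∈ P, p) ^ m := by
  rw [← prod_pow]
  conv_lhs => rw [← Nat.prod_factorization_pow_eq_self hn]
  rw [Finsupp.prod, Nat.support_factorization]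
  refine (prod_dvd_prod_of_dvd _ _ fun p hp => pow_dvd_pow p ?_).trans
    (prod_dvd_prod_of_subset _ _ _ h)
  have hp' := Nat.prime_of_mem_primeFactors hp
  exact ((Nat.pow_lt_pow_iff_right one_lt_two).1 (((Nat.pow_le_pow_left hp'.two_le _).trans
    (Nat.ordProj_le p hn)).trans_lt hm)).le

theorem sum_range_pow_div_eq (p e : ℕ) (hp : p ≠ 0) :
    ((∑ i ∈ range (e + 1), p ^ i : ℕ) : ℚ) / p ^ e = ∑ i ∈ range (e + 1), ((p : ℚ)⁻¹) ^ i := by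
  have hp' : (p : ℚ) ≠ 0 := by exact_mod_cast hp
  rw [← sum_range_reflect (fun i => ((p : ℚ)⁻¹) ^ i)]
  push_cast
  rw [sum_div]
  refine sum_congr rfl fun i hi => ?_
  have hi' : i ≤ e := Nat.lt_succ_iff.1 (mem_range.1 hi)
  rw [inv_pow, div_eq_iff (pow_ne_zero _ hp'), ← div_eq_inv_mul,
    eq_div_iff (pow_ne_zero _ hp'), ← pow_add, Nat.add_sub_cancel' hi']

theorem sum_range_inv_pow_lt (p e : ℕ) (hp : 2 ≤ p) :
    ∑ i ∈ range (e + 1), ((p : ℚ)⁻¹) ^ i < p / (p - 1) := by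
  have hp' : (2 : ℚ) ≤ p := by exact_mod_cast hp
  have h := mul_neg_geom_sum ((p : ℚ)⁻¹) (e + 1)
  have hpos : (0 : ℚ) < (p : ℚ)⁻¹ ^ (e + 1) := by positivity
  rw [lt_div_iff₀ (by linarith)]
  have h1 : (p : ℚ) * (1 - (p : ℚ)⁻¹) = p - 1 := by field_simp
  rw [← h1]
  nlinarith

section Friend

variable {N : ℕ}

theorem prod_primeFactors_eq (hN : N ≠ 0)
    (h : 5 * (ArithmeticFunction.sigma 1) N = 9 * N) :
    ∏ p ∈ N.primeFactors, ∑ i ∈ range (N.factorization p + 1), ((p : ℚ)⁻¹) ^ i = 9 / 5 := by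
  have hs := ArithmeticFunction.sigma_eq_prod_primeFactors_sum_range_factorization_pow_mul
    (k := 1) hN
  simp only [mul_one] at hs
  have hprod : ∏ p ∈ N.primeFactors, (p : ℚ) ^ N.factorization p = N := by
    have := Nat.prod_factorization_pow_eq_self hN
    rw [Finsupp.prod, Nat.support_factorization] at this
    exact_mod_cast this
  calc _ = ∏ p ∈ N.primeFactors,
        ((∑ i ∈ range (N.factorization p + 1), p ^ i : ℕ) : ℚ) / p ^ N.factorization p :=
        prod_congr rfl fun p hp =>
          (sum_range_pow_div_eq _ _ (Nat.prime_of_mem_primeFactors hp).ne_zero).symm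
    _ = (ArithmeticFunction.sigma 1 N : ℕ) / N := by
        rw [prod_div_distrib, hprod, hs, Nat.cast_prod]
    _ = 9 / 5 := by
        have hN' : (N : ℚ) ≠ 0 := by exact_mod_cast hN
        rw [div_eq_div_iff hN' (by norm_num)]
        have h' : (5 * (ArithmeticFunction.sigma 1 N : ℕ) : ℚ) = 9 * N := by exact_mod_cast h
        linarith

theorem prod_sum_inv_pow_le (hN : N ≠ 0) (h : 5 * (ArithmeticFunction.sigma 1) N = 9 * N)
    {K : Finset ℕ} (hK : K ⊆ N.primeFactors) (t : ℕ → ℕ) (ht : ∀ p ∈ K, t p ≤ N.factorization p) :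
    ∏ p ∈ K, ∑ i ∈ range (t p + 1), ((p : ℚ)⁻¹) ^ i ≤ 9 / 5 := by
  have mono (p : ℕ) {a b : ℕ} (hab : a ≤ b) :
      ∑ i ∈ range (a + 1), ((p : ℚ)⁻¹) ^ i ≤ ∑ i ∈ range (b + 1), ((p : ℚ)⁻¹) ^ i :=
    sum_le_sum_of_subset_of_nonneg (range_mono (by omega)) fun i _ _ => by positivity
  calc _ ≤ ∏ p ∈ K, ∑ i ∈ range (N.factorization p + 1), ((p : ℚ)⁻¹) ^ i :=
        prod_le_prod (fun p _ => sum_nonneg fun i _ => by positivity) fun p hp => mono p (ht p hp)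
    _ ≤ ∏ p ∈ N.primeFactors, ∑ i ∈ range (N.factorization p + 1), ((p : ℚ)⁻¹) ^ i :=
by
        rw [← prod_sdiff hK]
        refine le_mul_of_one_le_left
          (prod_nonneg fun p _ => sum_nonneg fun i _ => by positivity)
          (Finset.one_le_prod fun p _ => ?_)
        simpa using mono p (Nat.zero_le (N.factorization p))
    _ = 9 / 5 := prod_primeFactors_eq hN h

theorem lt_prod_div_sub_one (hN : N ≠ 0) (h : 5 * (ArithmeticFunction.sigma 1) N = 9 * N)
    (h5 : 5 ∣ N) : 9 / 5 < ∏ p ∈ N.primeFactors, (p : ℚ) / (p - 1) := by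
  rw [← prod_primeFactors_eq hN h]
  refine prod_lt_prod_of_nonempty (fun p hp => ?_) (fun p hp => ?_) ⟨5, ?_⟩
  · have := Nat.pos_of_mem_primeFactors hp
    exact sum_pos (fun i _ => by positivity) (by simp)
  · exact sum_range_inv_pow_lt _ _ (Nat.prime_of_mem_primeFactors hp).two_le
  · exact Nat.mem_primeFactors.2 ⟨by norm_num, h5, hN⟩

theorem sum_range_pow_dvd_sigma (hN : N ≠ 0) {p : ℕ} (hp : p ∈ N.primeFactors) :
    ∑ i ∈ range (N.factorization p + 1), p ^ i ∣ ArithmeticFunction.sigma 1 N := by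
  rw [ArithmeticFunction.sigma_eq_prod_primeFactors_sum_range_factorization_pow_mul hN]
  simpa only [mul_one] using
    dvd_prod_of_mem (fun p => ∑ i ∈ range (N.factorization p + 1), p ^ i) hp

theorem mem_primeFactors_of_dvd_sum (hN : N ≠ 0)
    (h : 5 * (ArithmeticFunction.sigma 1) N = 9 * N) {p w : ℕ} (hp : p ∈ N.primeFactors)
    (hw : w.Prime) (hw3 : w ≠ 3) (hd : w ∣ ∑ i ∈ range (N.factorization p + 1), p ^ i) :
    w ∈ N.primeFactors := by
  refine Nat.mem_primeFactors.2 ⟨hw, ?_, hN⟩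
  have h1 : w ∣ 3 ^ 2 * N := by
    have := (hd.trans (sum_range_pow_dvd_sigma hN hp)).mul_left 5
    rwa [h] at this
  refine (hw.dvd_mul.1 h1).resolve_left fun h9 => hw3 ?_
  exact (Nat.prime_dvd_prime_iff_eq hw Nat.prime_three).1 (hw.dvd_of_dvd_pow h9)

theorem five_dvd_friend (h : 5 * (ArithmeticFunction.sigma 1) N = 9 * N) : 5 ∣ N := by omega

theorem not_two_dvd_friend (hN : 10 < N) (h : 5 * (ArithmeticFunction.sigma 1) N = 9 * N) :
    ¬ 2 ∣ N := by
  intro h2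
  obtain ⟨k, rfl⟩ : 10 ∣ N := by have := five_dvd_friend h; omega
  have hsub : ({1, k, 2 * k, 5 * k, 10 * k} : Finset ℕ) ⊆ (10 * k).divisors := by
    intro d hd
    simp only [mem_insert, mem_singleton] at hd
    refine Nat.mem_divisors.2 ⟨?_, by omega⟩
    rcases hd with rfl | rfl | rfl | rfl | rfl
    · exact one_dvd _
    · exact dvd_mul_left _ _
    all_goals exact Nat.mul_dvd_mul_right (by norm_num) _
  have hle := sum_le_sum_of_subset (f := fun d => d) hsub
  rw [← ArithmeticFunction.sigma_one_apply, sum_insert, sum_insert, sum_insert, sum_insert,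
    sum_singleton] at hle
  · omega
  all_goals simp only [mem_insert, mem_singleton]; omega

theorem even_factorization_friend (hN : 10 < N)
    (h : 5 * (ArithmeticFunction.sigma 1) N = 9 * N) {p : ℕ} (hp : p ∈ N.primeFactors) :
    Even (N.factorization p) := by
  have h2 := not_two_dvd_friend hN h
  have hodd : ¬ 2 ∣ ∑ i ∈ range (N.factorization p + 1), p ^ i := fun hd => by
    have := hd.trans (sum_range_pow_dvd_sigma (by omega) hp)
    omega
  have hp2 : Odd p := by
    rw [← Nat.not_even_iff_odd, even_iff_two_dvd]
    exact fun hd => h2 (hd.trans (Nat.dvd_of_mem_primeFactors hp))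
  rw [← even_iff_two_dvd, Nat.not_even_iff_odd, odd_sum_iff_odd_card_odd] at hodd
  rw [filter_true_of_mem fun i _ => hp2.pow, card_range] at hodd
  grind

theorem two_le_factorization_friend (hN : 10 < N)
    (h : 5 * (ArithmeticFunction.sigma 1) N = 9 * N) {p : ℕ} (hp : p ∈ N.primeFactors) :
    2 ≤ N.factorization p := by
  have h1 := (Nat.prime_of_mem_primeFactors hp).factorization_pos_of_dvd (by omega)
    (Nat.dvd_of_mem_primeFactors hp)
  have := even_factorization_friend hN h hp
  grind

theorem not_three_dvd_friend (hN : 10 < N) (h : 5 * (ArithmeticFunction.sigma 1) N = 9 * N) :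
    ¬ 3 ∣ N := by
  intro h3
  have hN0 : N ≠ 0 := by omega
  have m3 : 3 ∈ N.primeFactors := Nat.mem_primeFactors.2 ⟨Nat.prime_three, h3, hN0⟩
  have m5 : 5 ∈ N.primeFactors := Nat.mem_primeFactors.2 ⟨Nat.prime_five, five_dvd_friend h, hN0⟩
  have two_le {p : ℕ} (hp : p ∈ N.primeFactors) := two_le_factorization_friend hN h hp
  have he3 := even_factorization_friend hN h m3
  rcases (two_le m3).eq_or_lt with he | he
  · have m13 : 13 ∈ N.primeFactors := by
      refine mem_primeFactors_of_dvd_sum hN0 h m3 (by norm_num) (by norm_num) ?_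
      rw [← he]
      decide
    have := prod_sum_inv_pow_le hN0 h (K := {3, 5, 13})
      (by simp only [insert_subset_iff, singleton_subset_iff, *, and_self])
      (fun _ => 2) fun p hp => by
        simp only [mem_insert, mem_singleton] at hp
        rcases hp with rfl | rfl | rfl <;> apply two_le <;> assumption
    norm_num [sum_range_succ] at this
  · have := prod_sum_inv_pow_le hN0 h (K := {3, 5})
      (by simp only [insert_subset_iff, singleton_subset_iff, *, and_self])
      (fun p => if p = 3 then 4 else 2) (by simp [two_le m5]; grind)
    norm_num [sum_range_succ] at this

theorem seven_le_of_mem_primeFactors_friend (hN : 10 < N)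
    (h : 5 * (ArithmeticFunction.sigma 1) N = 9 * N) {p : ℕ} (hp : p ∈ N.primeFactors)
    (hp5 : p ≠ 5) : 7 ≤ p := by
  have hd := Nat.dvd_of_mem_primeFactors hp
  have hpp := Nat.prime_of_mem_primeFactors hp
  have h2 : p ≠ 2 := by rintro rfl; exact not_two_dvd_friend hN h hd
  have h3 : p ≠ 3 := by rintro rfl; exact not_three_dvd_friend hN h hd
  by_contra! hlt
  interval_cases p <;> contradiction

/-- Some prime factor `q ≡ 1 [MOD 5]` of a friend `N` of 10 is such that all prime factors of
`1 + q + q ^ 2 + q ^ 3 + q ^ 4` divide `N`, and it is not the only prime factor `≡ 1 [MOD 5]`. -/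
theorem exists_sum_range_five_friend (hN : 10 < N)
    (h : 5 * (ArithmeticFunction.sigma 1) N = 9 * N) :
    ∃ q ∈ N.primeFactors, q % 5 = 1 ∧ (∃ v ∈ N.primeFactors, v ≠ q ∧ v % 5 = 1) ∧
      ∀ w ∈ (∑ i ∈ range 5, q ^ i).primeFactors, w ∈ N.primeFactors ∧ (w = 5 ∨ w % 5 = 1) := by
  have hN0 : N ≠ 0 := by omega
  have m5 : 5 ∈ N.primeFactors := Nat.mem_primeFactors.2 ⟨Nat.prime_five, five_dvd_friend h, hN0⟩
  have h25 : 5 ^ 2 ∣ N := (pow_dvd_pow 5 (two_le_factorization_friend hN h m5)).trans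
    (Nat.ordProj_dvd N 5)
  have hσ : 5 ∣ ArithmeticFunction.sigma 1 N := by omega
  rw [ArithmeticFunction.sigma_eq_prod_primeFactors_sum_range_factorization_pow_mul hN0] at hσ
  simp only [mul_one] at hσ
  obtain ⟨q, hq, hd⟩ := Nat.prime_five.prime.exists_mem_finset_dvd hσ
  have he := even_factorization_friend hN h hq
  obtain ⟨h1, h5⟩ := modEq_one_of_dvd_sum_range_pow Nat.prime_five (Nat.succ_ne_zero _)
    (Nat.Coprime.pow_right 2 (Nat.coprime_two_right.2 he.add_one)) hd
  have hqp := Nat.prime_of_mem_primeFactors hq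
  have hΦ {w : ℕ} (hwp : w.Prime) (hwd : w ∣ ∑ i ∈ range 5, q ^ i) :
      w ∈ N.primeFactors ∧ (w = 5 ∨ w % 5 = 1) := by
    have h1w : w = 5 ∨ w % 5 = 1 := by
      refine (eq_or_modEq_one_of_dvd_sum_range_pow (k := 0) hwp Nat.prime_five
        (by simpa using hwd)).imp_right fun hdvd => ?_
      have := hwp.two_le
      omega
    exact ⟨mem_primeFactors_of_dvd_sum hN0 h hq hwp (by omega)
      (hwd.trans (sum_range_pow_dvd_sum_range_pow h5 q)), h1w⟩
  refine ⟨q, hq, h1, ?_, fun w hw =>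
    hΦ (Nat.prime_of_mem_primeFactors hw) (Nat.dvd_of_mem_primeFactors hw)⟩
  obtain ⟨a, ha⟩ : ∃ a, q = 5 * a + 1 := ⟨q / 5, by change q % 5 = 1 at h1; omega⟩
  have ha0 : a ≠ 0 := by
    rintro rfl
    exact hqp.one_lt.ne' ha
  have hsum : ∑ i ∈ range 5, q ^ i =
      5 * (5 * (2 * a + 10 * a ^ 2 + 25 * a ^ 3 + 25 * a ^ 4) + 1) := by
    simp only [sum_range_succ, range_zero, sum_empty, ha]
    ring
  obtain ⟨v, hvp, hvd⟩ := Nat.exists_prime_and_dvd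
    (show 5 * (2 * a + 10 * a ^ 2 + 25 * a ^ 3 + 25 * a ^ 4) + 1 ≠ 1 by simp [ha0])
  have hvΦ : v ∣ ∑ i ∈ range 5, q ^ i := hsum ▸ hvd.mul_left 5
  refine ⟨v, (hΦ hvp hvΦ).1, ?_, (hΦ hvp hvΦ).2.resolve_left ?_⟩
  · rintro rfl
    have h1 : v ∣ v * (v ^ 3 + v ^ 2 + v + 1) + 1 := by
      convert hvΦ using 1
      simp only [sum_range_succ, range_zero, sum_empty]
      ring
    exact hvp.one_lt.ne' (Nat.dvd_one.1 ((Nat.dvd_add_right (dvd_mul_right _ _)).1 h1))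
  · rintro rfl
    omega

/-- A friend of 10 has either two prime factors `r ≡ 1 [MOD 3]` whose exponent is `2` modulo `3`,
or one such prime factor together with another prime factor `w ≡ 1 [MOD 9]`. -/
theorem exists_sum_range_three_friend (hN : 10 < N)
    (h : 5 * (ArithmeticFunction.sigma 1) N = 9 * N) :
    ∃ r ∈ N.primeFactors, ∃ w ∈ N.primeFactors, r ≠ w ∧ r % 3 = 1 ∧
      3 ∣ N.factorization r + 1 ∧ w % 3 = 1 ∧ (w % 9 = 1 ∨ 3 ∣ N.factorization w + 1) := by
  have hN0 : N ≠ 0 := by omega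
  have hσ : 3 ^ 2 ∣ ArithmeticFunction.sigma 1 N := by omega
  rw [ArithmeticFunction.sigma_eq_prod_primeFactors_sum_range_factorization_pow_mul hN0] at hσ
  simp only [mul_one] at hσ
  have three {r : ℕ} (hr : r ∈ N.primeFactors)
      (hd : 3 ∣ ∑ i ∈ range (N.factorization r + 1), r ^ i) :
      r % 3 = 1 ∧ 3 ∣ N.factorization r + 1 :=
    modEq_one_of_dvd_sum_range_pow Nat.prime_three (Nat.succ_ne_zero _)
      (Nat.coprime_two_right.2 (even_factorization_friend hN h hr).add_one) hd
  rcases sq_dvd_prod Nat.prime_three hσ with ⟨r, hr, hd⟩ | ⟨r, hr, w, hw, hne, hdr, hdw⟩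
  swap
  · exact ⟨r, hr, w, hw, hne, (three hr hdr).1, (three hr hdr).2, (three hw hdw).1,
      Or.inr (three hw hdw).2⟩
  obtain ⟨hr1, hr3⟩ := three hr ((dvd_pow_self 3 two_ne_zero).trans hd)
  have hrp := Nat.prime_of_mem_primeFactors hr
  obtain ⟨m, hm⟩ := hr3
  obtain ⟨a, rfl⟩ : ∃ a, r = 3 * a + 1 := ⟨r / 3, by omega⟩
  set r := 3 * a + 1 with hra
  have hsum (b : ℕ) : ∑ i ∈ range 3, (3 * b + 1) ^ i = 3 * (3 * (b ^ 2 + b) + 1) := by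
    simp only [sum_range_succ, range_zero, sum_empty]
    ring
  have h9 : 9 ∣ N.factorization r + 1 := by
    rw [hm, sum_range_mul_pow, hra, hsum, pow_two, mul_assoc] at hd
    have h3 := Nat.Coprime.dvd_of_dvd_mul_left (by simp)
      (Nat.dvd_of_mul_dvd_mul_left (by norm_num) hd)
    have hm2 : Odd m := by
      have := (even_factorization_friend hN h hr).add_one
      rw [hm] at this
      exact (Nat.odd_mul.1 this).2
    have := (modEq_one_of_dvd_sum_range_pow Nat.prime_three (by omega)
      (Nat.coprime_two_right.2 hm2) h3).2
    omega
  obtain ⟨b, hb⟩ : ∃ b, r ^ 3 = 3 * b + 1 := by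
    refine ⟨9 * a ^ 3 + 9 * a ^ 2 + 3 * a, ?_⟩
    rw [hra]
    ring
  have hΦ : ∑ i ∈ range 3, (r ^ 3) ^ i = 3 * (3 * (b ^ 2 + b) + 1) := by rw [hb, hsum]
  have hb0 : b ≠ 0 := by
    rintro rfl
    have := Nat.one_lt_pow (n := 3) (by norm_num) hrp.one_lt
    omega
  obtain ⟨w, hwp, hwd⟩ := Nat.exists_prime_and_dvd
    (show 3 * (b ^ 2 + b) + 1 ≠ 1 by simp [hb0])
  have hw3 : w ≠ 3 := by
    rintro rfl
    omega
  have hwΦ : w ∣ ∑ i ∈ range 3, (r ^ 3) ^ i := hΦ ▸ hwd.mul_left 3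
  have hw9 : 3 ^ (1 + 1) ∣ w - 1 := (eq_or_modEq_one_of_dvd_sum_range_pow (k := 1) hwp
    Nat.prime_three (by simpa using hwΦ)).resolve_left hw3
  have hw1 : w % 9 = 1 := by
    have := hwp.two_le
    omega
  refine ⟨r, hr, w, mem_primeFactors_of_dvd_sum hN0 h hr hwp hw3 ?_, ?_, hr1, ⟨m, hm⟩, by omega,
    Or.inl hw1⟩
  · refine hwΦ.trans (Dvd.dvd.trans ?_ (sum_range_pow_dvd_sum_range_pow h9 r))
    rw [show 9 = 3 * 3 by rfl, sum_range_mul_pow]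
    exact dvd_mul_left _ _
  · intro hrw
    rw [← hrw] at hwΦ
    have h1 : r ∣ r * (r ^ 5 + r ^ 2) + 1 := by
      convert hwΦ using 1
      simp only [sum_range_succ, range_zero, sum_empty]
      ring
    exact hrp.one_lt.ne' (Nat.dvd_one.1 ((Nat.dvd_add_right (dvd_mul_right _ _)).1 h1))

theorem lt_prod_mul_prod_of_card_le (hN : N ≠ 0)
    (h : 5 * (ArithmeticFunction.sigma 1) N = 9 * N) (hcard : N.primeFactors.card ≤ 6)
    {K B : Finset ℕ} (hK : K ⊆ N.primeFactors) (hKB : 6 ≤ K.card + B.card)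
    (hB : ∀ p ∈ B, 2 ≤ p) (hle : ∀ p ∈ N.primeFactors, p ∉ K → p ∉ B → ∀ b ∈ B, b ≤ p) :
    9 / 5 < (∏ p ∈ K, (p : ℚ) / (p - 1)) * ∏ p ∈ B, (p : ℚ) / (p - 1) :=
  (lt_prod_div_sub_one hN h (five_dvd_friend h)).trans_le
    (prod_div_sub_one_le hK (hcard.trans hKB)
      (fun _ hp => (Nat.prime_of_mem_primeFactors hp).two_le) hB hle)

theorem seven_mem_primeFactors_friend (hN : 10 < N)
    (h : 5 * (ArithmeticFunction.sigma 1) N = 9 * N) (hcard : N.primeFactors.card ≤ 6) :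
    7 ∈ N.primeFactors := by
  by_contra m7
  have := lt_prod_mul_prod_of_card_le (by omega) h hcard (K := ∅) (B := {5, 11, 13, 17, 19, 23})
    (empty_subset _) (by decide) (by decide) fun p hp _ hpB b hb => by
      have hpp := Nat.prime_of_mem_primeFactors hp
      simp only [mem_insert, mem_singleton, not_or] at hpB hb
      have h7 := seven_le_of_mem_primeFactors_friend hN h hp hpB.1
      by_contra! hlt
      replace hlt : p < 23 := by omega
      interval_cases p <;> contradiction
  norm_num at this

theorem thirtyone_le_of_modEq_one {p : ℕ} (hp : p.Prime) (h5 : p % 5 = 1) (h11 : p ≠ 11) :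
    31 ≤ p := by
  by_contra! hlt
  interval_cases p <;> contradiction

theorem eleven_mem_primeFactors_friend (hN : 10 < N)
    (h : 5 * (ArithmeticFunction.sigma 1) N = 9 * N) (hcard : N.primeFactors.card ≤ 6) :
    11 ∈ N.primeFactors := by
  have hN0 : N ≠ 0 := by omega
  by_contra m11
  have m5 : 5 ∈ N.primeFactors := Nat.mem_primeFactors.2 ⟨Nat.prime_five, five_dvd_friend h, hN0⟩
  have m7 := seven_mem_primeFactors_friend hN h hcard
  obtain ⟨u, hu, v, hv, huv, hu5, hv5⟩ : ∃ u ∈ N.primeFactors, ∃ v ∈ N.primeFactors,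
      u < v ∧ u % 5 = 1 ∧ v % 5 = 1 := by
    obtain ⟨q, hq, hq5, ⟨v, hv, hvq, hv5⟩, -⟩ := exists_sum_range_five_friend hN h
    rcases lt_or_gt_of_ne hvq with hlt | hlt
    · exact ⟨v, hv, q, hq, hlt, hv5, hq5⟩
    · exact ⟨q, hq, v, hv, hlt, hq5, hv5⟩
  have hvp := Nat.prime_of_mem_primeFactors hv
  have hu31 := thirtyone_le_of_modEq_one (Nat.prime_of_mem_primeFactors hu) hu5
    (by rintro rfl; exact m11 hu)
  have hv41 : 41 ≤ v := by
    by_contra! hlt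
    obtain rfl : v = 36 := by omega
    norm_num at hvp
  have := lt_prod_mul_prod_of_card_le (by omega) h hcard (K := {u, v, 5, 7}) (B := {13, 17})
    (by simp only [insert_subset_iff, singleton_subset_iff, *, and_self])
    (by
      rw [card_insert_of_notMem, card_insert_of_notMem]
      · decide
      all_goals simp only [mem_insert, mem_singleton]; omega)
    (by decide) fun p hp hpK hpB b hb => by
      have hpp := Nat.prime_of_mem_primeFactors hp
      simp only [mem_insert, mem_singleton, not_or] at hpB hpK hb
      have h7 := seven_le_of_mem_primeFactors_friend hN h hp (by omega)
      by_contra! hlt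
      replace hlt : p < 17 := by omega
      interval_cases p <;> first | contradiction | omega
  rw [prod_insert (by simp only [mem_insert, mem_singleton]; omega),
    prod_insert (by simp only [mem_insert, mem_singleton]; omega)] at this
  have h1 := div_sub_one_anti (by norm_num) hu31
  have h2 := div_sub_one_anti (by norm_num) hv41
  have h3 : (0 : ℚ) ≤ v / (v - 1) :=
    div_nonneg (by positivity) (sub_nonneg.2 (by exact_mod_cast hvp.one_le))
  have h4 := mul_le_mul h1 h2 h3 (by norm_num)
  norm_num at this h4
  linarith

/-- If `ω(N) ≤ 6`, all prime factors of a friend `N` of 10 are small. The prime 13 makes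
`19 ∤ N`, and the primes `≡ 1 [MOD 3]` forced by `9 ∣ σ(N)` then leave no room for a large prime. -/
theorem lt_of_mem_primeFactors_friend (hN : 10 < N)
    (h : 5 * (ArithmeticFunction.sigma 1) N = 9 * N) (hcard : N.primeFactors.card ≤ 6) {u : ℕ}
    (hu : u ∈ N.primeFactors) : u < 2400 := by
  have hN0 : N ≠ 0 := by omega
  have m5 : 5 ∈ N.primeFactors := Nat.mem_primeFactors.2 ⟨Nat.prime_five, five_dvd_friend h, hN0⟩
  have m7 := seven_mem_primeFactors_friend hN h hcard
  have m11 := eleven_mem_primeFactors_friend hN h hcard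
  by_contra! hlarge
  have h1 := div_sub_one_anti (by norm_num) hlarge
  by_cases m13 : 13 ∈ N.primeFactors
  swap
  · have := lt_prod_mul_prod_of_card_le (by omega) h hcard (K := {u, 5, 7, 11}) (B := {17, 19})
      (by simp only [insert_subset_iff, singleton_subset_iff, *, and_self])
      (by
        rw [card_insert_of_notMem]
        · decide
        all_goals simp only [mem_insert, mem_singleton]; omega)
      (by decide) fun p hp hpK hpB b hb => by
        have hpp := Nat.prime_of_mem_primeFactors hp
        simp only [mem_insert, mem_singleton, not_or] at hpB hpK hb
        have h7 := seven_le_of_mem_primeFactors_friend hN h hp (by omega)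
        by_contra! hlt
        replace hlt : p < 19 := by omega
        interval_cases p <;> first | contradiction | omega
    rw [prod_insert (by simp only [mem_insert, mem_singleton]; omega)] at this
    norm_num at this h1
    linarith
  have m19 : 19 ∉ N.primeFactors := fun m19 => by
    have := prod_sum_inv_pow_le hN0 h (K := {5, 7, 11, 13, 19})
      (by simp only [insert_subset_iff, singleton_subset_iff, *, and_self]) (fun _ => 2) fun p hp =>
        two_le_factorization_friend hN h (by
          simp only [mem_insert, mem_singleton] at hp
          rcases hp with rfl | rfl | rfl | rfl | rfl <;> assumption)
    norm_num [sum_range_succ] at this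
  have no_second {y : ℕ} (hy : y ∈ N.primeFactors) (hyu : y ≠ u) : y < 31 := by
    by_contra! hy31
    have := lt_prod_mul_prod_of_card_le (by omega) h hcard (K := {u, y, 5, 7, 11, 13}) (B := ∅)
      (by simp only [insert_subset_iff, singleton_subset_iff, *, and_self])
      (by
        rw [card_insert_of_notMem, card_insert_of_notMem]
        · decide
        all_goals simp only [mem_insert, mem_singleton]; omega)
      (by simp) (by simp)
    rw [prod_insert (by simp only [mem_insert, mem_singleton]; omega),
      prod_insert (by simp only [mem_insert, mem_singleton]; omega)] at this
    have h2 := div_sub_one_anti (by norm_num) hy31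
    have h3 : (0 : ℚ) ≤ y / (y - 1) :=
      div_nonneg (by positivity) (sub_nonneg.2 (by exact_mod_cast (by omega : 1 ≤ y)))
    have h4 := mul_le_mul h1 h2 h3 (by norm_num)
    norm_num at this h4
    linarith
  have hm {r : ℕ} (hr : r ∈ N.primeFactors) (h3 : 3 ∣ N.factorization r + 1) :
      r ≠ 7 ∧ r ≠ 13 := by
    have hd := sum_range_pow_dvd_sum_range_pow h3 r
    constructor
    · rintro rfl
      exact m19 (mem_primeFactors_of_dvd_sum hN0 h hr (by norm_num) (by norm_num)
        (Dvd.dvd.trans (by decide) hd))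
    · rintro rfl
      have := no_second (mem_primeFactors_of_dvd_sum (w := 61) hN0 h hr (by norm_num) (by norm_num)
        (Dvd.dvd.trans (by decide) hd)) (by omega)
      omega
  have large {r : ℕ} (hr : r ∈ N.primeFactors) (h3 : r % 3 = 1) (h7 : r ≠ 7) (h13 : r ≠ 13) :
      31 ≤ r := by
    have hrp := Nat.prime_of_mem_primeFactors hr
    by_contra! hlt
    interval_cases r <;> contradiction
  obtain ⟨r, hr, w, hw, hrw, hr1, hr3, hw1, hw9⟩ := exists_sum_range_three_friend hN h
  have hr31 := large hr hr1 (hm hr hr3).1 (hm hr hr3).2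
  have hw31 : 31 ≤ w := by
    rcases hw9 with hw9 | hw3
    · exact large hw hw1 (by omega) (by omega)
    · exact large hw hw1 (hm hw hw3).1 (hm hw hw3).2
  by_cases hru : r = u
  · have := no_second hw (by omega)
    omega
  · have := no_second hr hru
    omega

/-- For these `u`, neither `Φ₅(11)` nor `Φ₅(u)` is a product of powers of `5`, `11` and `u`. -/
theorem sum_range_five_not_dvd (u : ℕ) (hu : u < 2400) (hu5 : u % 5 = 1) (h11 : 11 < u) :
    ∀ q ∈ [11, u], ¬ 1 + q + q ^ 2 + q ^ 3 + q ^ 4 ∣ (5 * (11 * u)) ^ 64 := by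
  revert u
  decide +kernel

theorem sum_range_five_not_dvd' (w : ℕ) (hw : w < 600) (hw5 : w % 5 = 1) (v : ℕ)
    (hv : v ∈ [31, 41]) (hvw : v < w) :
    ∀ q ∈ [11, v, w], ¬ 1 + q + q ^ 2 + q ^ 3 + q ^ 4 ∣ (5 * (11 * (v * w))) ^ 64 := by
  revert w v
  decide +kernel

theorem sum_range_five_dvd {q : ℕ} (hq : q < 2400) {P : Finset ℕ}
    (h : (∑ i ∈ range 5, q ^ i).primeFactors ⊆ P) :
    1 + q + q ^ 2 + q ^ 3 + q ^ 4 ∣ (∏ p ∈ P, p) ^ 64 := by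
  have hlt : ∑ i ∈ range 5, q ^ i < 2 ^ 64 :=
    (sum_le_sum fun i _ => Nat.pow_le_pow_left hq.le i).trans_lt (by decide)
  have hne : ∑ i ∈ range 5, q ^ i ≠ 0 := by simp [sum_range_succ']
  simpa [sum_range_succ] using dvd_prod_pow_of_primeFactors_subset hne h hlt

end Friend

/-- If `N` is a friend of 10 (i.e. `N > 10` and `σ(N)/N = 9/5`), then `N` has at
least 7 distinct prime factors. -/
theorem friend_of_ten_omega_ge_seven (N : ℕ) (hN : 10 < N)
    (hfriend : 5 * (ArithmeticFunction.sigma 1) N = 9 * N) :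
    7 ≤ N.primeFactors.card := by
  by_contra! hlt
  have hcard : N.primeFactors.card ≤ 6 := by omega
  have hN0 : N ≠ 0 := by omega
  have m5 : 5 ∈ N.primeFactors :=
    Nat.mem_primeFactors.2 ⟨Nat.prime_five, five_dvd_friend hfriend, hN0⟩
  have m7 := seven_mem_primeFactors_friend hN hfriend hcard
  have m11 := eleven_mem_primeFactors_friend hN hfriend hcard
  have le31 {p : ℕ} (hp : p ∈ N.primeFactors) (h5 : p % 5 = 1) (h11 : p ≠ 11) : 31 ≤ p :=
    thirtyone_le_of_modEq_one (Nat.prime_of_mem_primeFactors hp) h5 h11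
  obtain ⟨q, hq, hq5, ⟨u, hu, huq, hu5⟩, hΦ⟩ := exists_sum_range_five_friend hN hfriend
  have hq2400 := lt_of_mem_primeFactors_friend hN hfriend hcard hq
  by_cases hthree : ∃ v ∈ N.primeFactors, ∃ w ∈ N.primeFactors,
      v < w ∧ v % 5 = 1 ∧ w % 5 = 1 ∧ v ≠ 11 ∧ w ≠ 11
  · obtain ⟨v, hv, w, hw, hvw, hv5, hw5, hv11, hw11⟩ := hthree
    have hvp := Nat.prime_of_mem_primeFactors hv
    have hv31 := le31 hv hv5 hv11
    have hbound := lt_prod_mul_prod_of_card_le hN0 hfriend hcard (K := {v, w, 5, 7, 11}) (B := {13})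
      (by simp only [insert_subset_iff, singleton_subset_iff, *, and_self])
      (by
        rw [card_insert_of_notMem, card_insert_of_notMem]
        · decide
        all_goals simp only [mem_insert, mem_singleton]; omega)
      (by decide) fun p hp hpK hpB b hb => by
        have hpp := Nat.prime_of_mem_primeFactors hp
        simp only [mem_insert, mem_singleton, not_or] at hpB hpK hb
        have h7 := seven_le_of_mem_primeFactors_friend hN hfriend hp (by omega)
        by_contra! hlt
        replace hlt : p < 13 := by omega
        interval_cases p <;> first | contradiction | omega
    rw [prod_insert (by simp only [mem_insert, mem_singleton]; omega),
      prod_insert (by simp only [mem_insert, mem_singleton]; omega)] at hbound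
    have absurd_of_le {a b : ℕ} (ha : 2 ≤ a) (hb : 2 ≤ b) (hav : a ≤ v) (hbw : b ≤ w)
        (hab : (a : ℚ) / (a - 1) * (b / (b - 1)) ≤ 10357 / 10000) : False := by
      have h3 : (0 : ℚ) ≤ w / (w - 1) :=
        div_nonneg (by positivity) (sub_nonneg.2 (by exact_mod_cast (by omega : 1 ≤ w)))
      have h4 := mul_le_mul (div_sub_one_anti ha hav) (div_sub_one_anti hb hbw) h3
        (div_nonneg (by positivity) (sub_nonneg.2 (by exact_mod_cast (by omega : 1 ≤ a))))
      have h5 := h4.trans hab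
      norm_num at hbound h5
      linarith
    have hw600 : w < 600 := by
      by_contra! hle
      exact absurd_of_le (by norm_num) (by norm_num) hv31 hle (by norm_num)
    have hv61 : v < 61 := by
      by_contra! hle
      exact absurd_of_le (by norm_num) (by norm_num) hle (hle.trans hvw.le) (by norm_num)
    have hv' : v ∈ [31, 41] := by
      interval_cases v <;> first | contradiction | simp
    have mem {p : ℕ} (hp : p ∈ N.primeFactors) (hp5 : p % 5 = 1) : p = 11 ∨ p = v ∨ p = w := by
      by_contra! hne
      have hp31 := le31 hp hp5 hne.1
      have := lt_prod_mul_prod_of_card_le hN0 hfriend hcard (K := {p, v, w, 5, 7, 11}) (B := ∅)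
        (by simp only [insert_subset_iff, singleton_subset_iff, *, and_self])
        (by
          rw [card_insert_of_notMem, card_insert_of_notMem, card_insert_of_notMem]
          · decide
          all_goals simp only [mem_insert, mem_singleton]; omega)
        (by simp) (by simp)
      rw [prod_insert (by simp only [mem_insert, mem_singleton]; omega),
        prod_insert (by simp only [mem_insert, mem_singleton]; omega),
        prod_insert (by simp only [mem_insert, mem_singleton]; omega)] at this
      have nonneg {a : ℕ} (ha : 31 ≤ a) : (0 : ℚ) ≤ a / (a - 1) :=
        div_nonneg (by positivity) (sub_nonneg.2 (by exact_mod_cast (by omega : 1 ≤ a)))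
      have le {a : ℕ} (ha : 31 ≤ a) := div_sub_one_anti (by norm_num) ha
      have hw31 : 31 ≤ w := by omega
      have h4 := mul_le_mul (le hp31) (mul_le_mul (le hv31) (le hw31) (nonneg hw31) (by norm_num))
        (mul_nonneg (nonneg hv31) (nonneg hw31)) (by norm_num)
      norm_num at this h4
      linarith
    refine sum_range_five_not_dvd' w hw600 hw5 v hv' hvw q (by simpa using mem hq hq5) ?_
    have := sum_range_five_dvd (P := {5, 11, v, w}) hq2400 fun p hp => by
      simpa using (hΦ p hp).2.imp_right (mem (hΦ p hp).1)
    rwa [prod_insert (by simp only [mem_insert, mem_singleton]; omega),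
      prod_insert (by simp only [mem_insert, mem_singleton]; omega), prod_pair hvw.ne] at this
  · push Not at hthree
    obtain ⟨v, hv, hv5, hv11⟩ : ∃ v ∈ N.primeFactors, v % 5 = 1 ∧ v ≠ 11 := by
      rcases eq_or_ne q 11 with rfl | hne
      · exact ⟨u, hu, hu5, huq⟩
      · exact ⟨q, hq, hq5, hne⟩
    have hv2400 := lt_of_mem_primeFactors_friend hN hfriend hcard hv
    have hv31 := le31 hv hv5 hv11
    have mem {p : ℕ} (hp : p ∈ N.primeFactors) (hp5 : p % 5 = 1) : p = 11 ∨ p = v := by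
      by_contra! hne
      rcases lt_or_gt_of_ne hne.2 with hlt | hlt
      · exact hv11 (hthree p hp v hv hlt hp5 hv5 hne.1)
      · exact hne.1 (hthree v hv p hp hlt hv5 hp5 hv11)
    refine sum_range_five_not_dvd v hv2400 hv5 (by omega) q (by simpa using mem hq hq5) ?_
    have := sum_range_five_dvd (P := {5, 11, v}) hq2400 fun p hp => by
      simpa using (hΦ p hp).2.imp_right (mem (hΦ p hp).1)
    rwa [prod_insert (by simp only [mem_insert, mem_singleton]; omega), prod_pair hv11.symm] at this
end

section
/- If N = 5^(2a)·m² is a friend of 10, where a and m are positive integers with 5 not dividing m, and Ω(m) ≤ K for some integer K, then N < 5·6^((2^(K−2a+1) − 1)²). -/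
/-- Tangent-line inequality for the convex function `s ↦ log (eˢ / (eˢ - 1))`. -/
lemma log_div_sub_one_add_le {x y : ℝ} (hx : 1 < x) (hy : 1 < y) :
    Real.log (x / (x - 1)) + (Real.log x - Real.log y) / (x - 1) ≤ Real.log (y / (y - 1)) := by
  have hx1 : 0 < x - 1 := by linarith
  have hy1 : 0 < y - 1 := by linarith
  have hx0 : 0 < x := by linarith
  have hy0 : 0 < y := by linarith
  have h := strictConcaveOn_log_Ioi.concaveOn.2
    (show x * (y - 1) / (y * (x - 1)) ∈ Set.Ioi (0 : ℝ) from by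
      rw [Set.mem_Ioi]; positivity)
    (show x / y ∈ Set.Ioi (0 : ℝ) from by rw [Set.mem_Ioi]; positivity)
    (show 0 ≤ (x - 1) / x by positivity) (show 0 ≤ 1 / x by positivity) (by field_simp; ring)
  have h1 : (x - 1) / x * (x * (y - 1) / (y * (x - 1))) + 1 / x * (x / y) = 1 := by
    field_simp; ring
  simp only [smul_eq_mul] at h
  rw [h1, Real.log_one, Real.log_div (by positivity) (by positivity),
    Real.log_mul (by positivity) (by positivity), Real.log_mul (by positivity) (by positivity),
    Real.log_div (by positivity) (by positivity)] at h
  rw [Real.log_div (by positivity) (by positivity), Real.log_div (by positivity) (by positivity)]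
  have h2 := mul_le_mul_of_nonneg_left h (show 0 ≤ x / (x - 1) by positivity)
  have h3 : x / (x - 1) * ((x - 1) / x * (Real.log x + Real.log (y - 1) -
      (Real.log y + Real.log (x - 1))) + 1 / x * (Real.log x - Real.log y)) =
      (Real.log x + Real.log (y - 1) - (Real.log y + Real.log (x - 1))) +
      (Real.log x - Real.log y) / (x - 1) := by
    field_simp
  rw [h3] at h2
  linarith

/-- Weak majorization against the Sylvester-type sequence `B ^ 2 ^ n + 1`. -/
lemma log_prod_div_sub_one_add_le {B : ℝ} (hB : 1 < B) (U : Finset ℕ) (hU : ∀ x ∈ U, 2 ≤ x)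
    (hV : ∀ V ⊆ U, V.Nonempty → B ^ 2 ^ V.card < (B - 1) * ∏ x ∈ V, (x : ℝ) + 1)
    (M : ℝ) (hM1 : 1 < M) (hM : ∀ x ∈ U, (x : ℝ) ≤ M) :
    Real.log (∏ x ∈ U, ((x : ℝ) / (x - 1))) +
      (Real.log (∏ x ∈ U, (x : ℝ)) - Real.log ((B ^ 2 ^ U.card - 1) / (B - 1))) / (M - 1) ≤
      Real.log ((1 - (B ^ 2 ^ U.card)⁻¹) * (B / (B - 1))) := by
  have hB1 : 0 < B - 1 := by linarith
  induction U using Finset.induction_on_max generalizing M with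
  | empty =>
    have : (1 - B⁻¹) * (B / (B - 1)) = 1 := by field_simp
    simp [this, div_self hB1.ne']
  | insert a U ha ih =>
    have haU : a ∉ U := fun h => lt_irrefl _ (ha a h)
    have ha2 : (2 : ℝ) ≤ a := by exact_mod_cast hU a (by simp)
    have hpos : ∀ x ∈ U, (0 : ℝ) < x := fun x hx => by
      have := hU x (by simp [hx])
      positivity
    have hpos1 : ∀ x ∈ U, (0 : ℝ) < x - 1 := fun x hx => by
      have : (2 : ℝ) ≤ x := by exact_mod_cast hU x (by simp [hx])
      linarith
    have hprod : 0 < ∏ x ∈ U, (x : ℝ) := Finset.prod_pos hpos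
    have hprod1 : 0 < ∏ x ∈ U, ((x : ℝ) / (x - 1)) :=
      Finset.prod_pos fun x hx => div_pos (hpos x hx) (hpos1 x hx)
    have IH := ih (fun x hx => hU x (by simp [hx]))
      (fun V hVU => hV V (hVU.trans (Finset.subset_insert _ _))) a (by linarith)
      (fun x hx => by exact_mod_cast (ha x hx).le)
    have hfull := hV _ (Finset.Subset.refl _) (Finset.insert_nonempty a U)
    rw [Finset.card_insert_of_notMem haU, Finset.prod_insert haU] at *
    rw [Finset.prod_insert haU]
    set n := U.card
    have hC : 1 < B ^ 2 ^ n := one_lt_pow₀ hB (by positivity)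
    set C := B ^ 2 ^ n
    have hC0 : 0 < C := by linarith
    have hCC : B ^ 2 ^ (n + 1) = C ^ 2 := by rw [pow_succ, pow_mul]
    rw [hCC] at hfull ⊢
    have tan := log_div_sub_one_add_le (x := a) (y := C + 1) (by linarith) (by linarith)
    have ha1 : (0 : ℝ) < a - 1 := by linarith
    have hC1 : 0 < C - 1 := by linarith
    have e1 : (C ^ 2 - 1) / (B - 1) = (C - 1) / (B - 1) * (C + 1) := by field_simp; ring
    have e2 : (1 - (C ^ 2)⁻¹) * (B / (B - 1)) =
        (1 - C⁻¹) * (B / (B - 1)) * ((C + 1) / (C + 1 - 1)) := by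
      rw [add_sub_cancel_right]
      field_simp
      ring
    have hinv : 0 < 1 - C⁻¹ := by
      have := inv_lt_one_of_one_lt₀ hC
      linarith
    have hδ : 0 ≤ Real.log (a * ∏ x ∈ U, (x : ℝ)) - Real.log ((C ^ 2 - 1) / (B - 1)) := by
      rw [sub_nonneg]
      apply Real.log_le_log
      · rw [e1]; positivity
      · rw [div_le_iff₀ hB1]; linarith
    have hmono : (Real.log (a * ∏ x ∈ U, (x : ℝ)) - Real.log ((C ^ 2 - 1) / (B - 1))) / (M - 1) ≤
        (Real.log (a * ∏ x ∈ U, (x : ℝ)) - Real.log ((C ^ 2 - 1) / (B - 1))) / (a - 1) :=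
      div_le_div_of_nonneg_left hδ ha1 (by linarith [hM a (by simp)])
    refine (add_le_add_right hmono _).trans ?_
    rw [e1, e2, Real.log_mul (by positivity) hprod1.ne', Real.log_mul (by positivity) hprod.ne',
      Real.log_mul (by positivity) (by positivity),
      Real.log_mul (mul_pos hinv (div_pos (by linarith) hB1)).ne'
        (by rw [add_sub_cancel_right]; positivity)]
    calc _ = (Real.log (∏ x ∈ U, ((x : ℝ) / (x - 1))) +
          (Real.log (∏ x ∈ U, (x : ℝ)) - Real.log ((C - 1) / (B - 1))) / (a - 1)) +
          (Real.log (a / (a - 1)) + (Real.log a - Real.log (C + 1)) / (a - 1)) := by ring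
      _ ≤ _ := add_le_add IH tan

/-- A finite set of integers `x ≥ 2` for which `∏ x / (x - 1)` is at least `B / (B - 1)` contains
a nonempty subset with small product. -/
lemma exists_subset_prod_le {B : ℝ} (hB : 1 < B) (U : Finset ℕ) (hU : ∀ x ∈ U, 2 ≤ x)
    (h : B / (B - 1) ≤ ∏ x ∈ U, ((x : ℝ) / (x - 1))) :
    ∃ V ⊆ U, V.Nonempty ∧ (B - 1) * ∏ x ∈ V, (x : ℝ) + 1 ≤ B ^ 2 ^ V.card := by
  by_contra! hV
  have hB1 : 0 < B - 1 := by linarith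
  have hC : 1 < B ^ 2 ^ U.card := one_lt_pow₀ hB (by positivity)
  have hprod : 0 < ∏ x ∈ U, (x : ℝ) := Finset.prod_pos fun x hx => by
    have := hU x hx
    positivity
  have key := log_prod_div_sub_one_add_le hB U hU hV (2 + ∑ x ∈ U, (x : ℝ))
    (by have : 0 ≤ ∑ x ∈ U, (x : ℝ) := by positivity
        linarith)
    (fun x hx => by
      have := Finset.single_le_sum (f := fun x : ℕ => (x : ℝ)) (fun i _ => by positivity) hx
      linarith)
  have hδ : 0 ≤ Real.log (∏ x ∈ U, (x : ℝ)) - Real.log ((B ^ 2 ^ U.card - 1) / (B - 1)) := by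
    rcases U.eq_empty_or_nonempty with rfl | hne
    · simp [div_self hB1.ne']
    · rw [sub_nonneg]
      apply Real.log_le_log
      · apply div_pos <;> linarith
      · rw [div_le_iff₀ hB1]
        linarith [hV U (Finset.Subset.refl _) hne]
  have hM : 0 ≤ 2 + ∑ x ∈ U, (x : ℝ) - 1 := by
    have : 0 ≤ ∑ x ∈ U, (x : ℝ) := by positivity
    linarith
  have h1 := div_nonneg hδ hM
  have hBB : 0 < B / (B - 1) := div_pos (by linarith) hB1
  have hinv := inv_lt_one_of_one_lt₀ hC
  have hinv0 : 0 < (B ^ 2 ^ U.card)⁻¹ := by positivity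
  have h2 : Real.log (B / (B - 1)) ≤ Real.log ((1 - (B ^ 2 ^ U.card)⁻¹) * (B / (B - 1))) :=
    (Real.log_le_log hBB h).trans (by linarith)
  rw [Real.log_le_log_iff hBB (mul_pos (by linarith) hBB)] at h2
  nlinarith [mul_pos hinv0 hBB]

lemma one_sub_sum_le_prod_one_sub {ι : Type*} [DecidableEq ι] (s : Finset ι) (f : ι → ℝ)
    (h0 : ∀ i ∈ s, 0 ≤ f i) (h1 : ∀ i ∈ s, f i ≤ 1) :
    1 - ∑ i ∈ s, f i ≤ ∏ i ∈ s, (1 - f i) := by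
  induction s using Finset.induction_on with
  | empty => simp
  | insert a s ha ih =>
    rw [Finset.sum_insert ha, Finset.prod_insert ha]
    have IH := ih (fun i hi => h0 i (by simp [hi])) (fun i hi => h1 i (by simp [hi]))
    have hp : ∏ i ∈ s, (1 - f i) ≤ 1 := Finset.prod_le_one
      (fun i hi => sub_nonneg.2 (h1 i (by simp [hi])))
      (fun i hi => by linarith [h0 i (by simp [hi])])
    nlinarith [h0 a (by simp)]

/-- Here `S p` plays the role of `σ (p ^ e p)`. The primes of `F` are known together with their
exponents, those of `H` without them, and those of `U` are unknown. -/
lemma log_prod_le_of_partial {Q : Finset ℕ} {e S : ℕ → ℕ} {c : ℕ → ℝ}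
    (hprime : ∀ p ∈ Q, p.Prime) (h5 : ∀ p ∈ Q, 5 ≤ p) (he : ∀ p ∈ Q, 1 ≤ e p)
    (hS : ∀ p ∈ Q, (S p : ℝ) * (p - 1) = p ^ (e p + 1) - 1)
    (heq : 5 * ∏ p ∈ Q, S p = 9 * ∏ p ∈ Q, p ^ e p) (hc : ∀ p ∈ Q, 0 ≤ c p)
    (hstep : ∀ F H : Finset ℕ, Disjoint F H → F ∪ H ⊆ Q → 5 ∈ F ∪ H →
      1 / (5 * (∏ p ∈ F, (S p : ℝ)) * ∏ p ∈ H, (p : ℝ)) ≤ ∑ p ∈ H, 1 / (p : ℝ) ^ (e p + 1) →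
      ∃ p ∈ H, Real.log (5 * (∏ p ∈ F, (S p : ℝ)) * (∏ p ∈ H, (p : ℝ)) * (S p / p) + 1) ≤
        c p * Real.log (5 * (∏ p ∈ F, (S p : ℝ)) * (∏ p ∈ H, (p : ℝ)) + 1))
    (n : ℕ) (F H U : Finset ℕ) (hn : H.card + 2 * U.card = n) (hFH : Disjoint F H)
    (hFU : Disjoint F U) (hHU : Disjoint H U) (hQ : F ∪ H ∪ U = Q) (h5F : 5 ∈ F ∪ H) :
    Real.log (5 * (∏ p ∈ Q, (S p : ℝ)) + 1) ≤ 2 ^ U.card * (∏ p ∈ H ∪ U, c p) *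
      Real.log (5 * (∏ p ∈ F, (S p : ℝ)) * (∏ p ∈ H, (p : ℝ)) + 1) := by
  induction n using Nat.strong_induction_on generalizing F H U with
  | _ n ih =>
  have hFQ : ∀ p ∈ F, p ∈ Q := fun p hp => by simp [← hQ, hp]
  have hHQ : ∀ p ∈ H, p ∈ Q := fun p hp => by simp [← hQ, hp]
  have hUQ : ∀ p ∈ U, p ∈ Q := fun p hp => by simp [← hQ, hp]
  have hp5 : ∀ p ∈ Q, (5 : ℝ) ≤ p := fun p hp => by exact_mod_cast h5 p hp
  have hSlow : ∀ p ∈ Q, (p : ℝ) ^ e p < S p := fun p hp => by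
    have h := hS p hp
    have h1 := hp5 p hp
    have h2 : (1 : ℝ) < p ^ e p := one_lt_pow₀ (by linarith) (by have := he p hp; omega)
    rw [pow_succ] at h
    nlinarith
  have hSupp : ∀ p ∈ Q, (S p : ℝ) / p ^ e p ≤ p / (p - 1) := fun p hp => by
    have h := hS p hp
    have h1 := hp5 p hp
    rw [div_le_div_iff₀ (by positivity) (by linarith), h, pow_succ]
    linarith
  have hSpos : ∀ p ∈ Q, (0 : ℝ) < S p := fun p hp =>
    lt_of_le_of_lt (by positivity) (hSlow p hp)
  set A : ℝ := 5 * (∏ p ∈ F, (S p : ℝ)) * (∏ p ∈ H, (p : ℝ)) with hA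
  have hFpos : 0 < ∏ p ∈ F, (S p : ℝ) := Finset.prod_pos fun p hp => hSpos p (hFQ p hp)
  have hHpos : 0 < ∏ p ∈ H, (p : ℝ) :=
    Finset.prod_pos fun p hp => by linarith [hp5 p (hHQ p hp)]
  have hApos : 0 < A := by positivity
  have hden : ∀ V ⊆ Q, 0 < ∏ p ∈ V, (p : ℝ) ^ e p := fun V hV =>
    Finset.prod_pos fun p hp => pow_pos (by linarith [hp5 p (hV hp)]) _
  set num : ℕ := 5 * (∏ p ∈ F, S p) * ∏ p ∈ H, p with hnum
  set D : ℕ := 9 * (∏ p ∈ F, p ^ e p) * ∏ p ∈ H, (p - 1) with hD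
  have hnumA : (num : ℝ) = A := by simp [hnum, hA]
  have hDR : (D : ℝ) = 9 * (∏ p ∈ F, (p : ℝ) ^ e p) * ∏ p ∈ H, ((p : ℝ) - 1) := by
    rw [hD]
    push_cast
    congr 1
    refine Finset.prod_congr rfl fun p hp => ?_
    rw [Nat.cast_sub (by have := h5 p (hHQ p hp); omega), Nat.cast_one]
  have hident : A * (∏ p ∈ H, (1 - 1 / (p : ℝ) ^ (e p + 1))) *
      ∏ p ∈ U, ((S p : ℝ) / p ^ e p) = D := by
    have hH : (∏ p ∈ H, (p : ℝ)) * (∏ p ∈ H, (1 - 1 / (p : ℝ) ^ (e p + 1))) =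
        (∏ p ∈ H, (S p : ℝ)) / (∏ p ∈ H, (p : ℝ) ^ e p) * ∏ p ∈ H, ((p : ℝ) - 1) := by
      rw [← Finset.prod_mul_distrib, ← Finset.prod_div_distrib, ← Finset.prod_mul_distrib]
      refine Finset.prod_congr rfl fun p hp => ?_
      have h := hS p (hHQ p hp)
      have h1 := hp5 p (hHQ p hp)
      rw [div_mul_eq_mul_div, h, pow_succ]
      field_simp
    have heqR : 5 * ((∏ p ∈ F, (S p : ℝ)) * (∏ p ∈ H, (S p : ℝ)) * ∏ p ∈ U, (S p : ℝ)) =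
        9 * ((∏ p ∈ F, (p : ℝ) ^ e p) * (∏ p ∈ H, (p : ℝ) ^ e p) * ∏ p ∈ U, (p : ℝ) ^ e p) := by
      rw [← Finset.prod_union hFH, ← Finset.prod_union hFH,
        ← Finset.prod_union (Finset.disjoint_union_left.2 ⟨hFU, hHU⟩),
        ← Finset.prod_union (Finset.disjoint_union_left.2 ⟨hFU, hHU⟩), hQ]
      exact_mod_cast heq
    have d2 := hden H hHQ
    have d3 := hden U hUQ
    rw [hDR, hA, mul_assoc (5 * _), hH, Finset.prod_div_distrib]
    field_simp
    linear_combination (∏ p ∈ H, ((p : ℝ) - 1)) * heqR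
  have hHle : ∀ p ∈ H, 1 / (p : ℝ) ^ (e p + 1) ≤ 1 := fun p hp => by
    have h1 := hp5 p (hHQ p hp)
    rw [div_le_one (by positivity)]
    exact one_le_pow₀ (by linarith)
  have hH1 : ∏ p ∈ H, (1 - 1 / (p : ℝ) ^ (e p + 1)) ≤ 1 :=
    Finset.prod_le_one (fun p hp => sub_nonneg.2 (hHle p hp))
      (fun p hp => by
        have : (0 : ℝ) ≤ 1 / (p : ℝ) ^ (e p + 1) := by positivity
        linarith)
  have hH0 : 0 ≤ ∏ p ∈ H, (1 - 1 / (p : ℝ) ^ (e p + 1)) :=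
    Finset.prod_nonneg fun p hp => sub_nonneg.2 (hHle p hp)
  have hUlt : ∀ p ∈ U, 1 < (S p : ℝ) / p ^ e p := fun p hp => by
    have h1 := hp5 p (hUQ p hp)
    rw [one_lt_div (by positivity)]
    exact hSlow p (hUQ p hp)
  have hU1 : 1 ≤ ∏ p ∈ U, ((S p : ℝ) / p ^ e p) := by
    have := Finset.prod_le_prod (s := U) (f := fun _ => (1 : ℝ))
      (g := fun p => (S p : ℝ) / p ^ e p) (fun _ _ => zero_le_one) (fun p hp => (hUlt p hp).le)
    simpa using this
  rcases lt_trichotomy num D with hlt | hEq | hgt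
  · have hltR : A + 1 ≤ D := by rw [← hnumA]; exact_mod_cast hlt
    have hB : (A + 1) / (A + 1 - 1) ≤ ∏ p ∈ U, ((p : ℝ) / (p - 1)) := by
      have h1 : ∏ p ∈ U, ((S p : ℝ) / p ^ e p) ≤ ∏ p ∈ U, ((p : ℝ) / (p - 1)) :=
        Finset.prod_le_prod (fun p _ => by positivity) (fun p hp => hSupp p (hUQ p hp))
      refine le_trans ?_ h1
      rw [add_sub_cancel_right, div_le_iff₀ hApos]
      calc A + 1 ≤ D := hltR
        _ = (A * ∏ p ∈ U, ((S p : ℝ) / p ^ e p)) *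
            ∏ p ∈ H, (1 - 1 / (p : ℝ) ^ (e p + 1)) := by rw [← hident]; ring
        _ ≤ (A * ∏ p ∈ U, ((S p : ℝ) / p ^ e p)) * 1 := by gcongr
        _ = _ := by ring
    obtain ⟨V, hVU, hVne, hV⟩ := exists_subset_prod_le (by linarith) U
      (fun p hp => by have := h5 p (hUQ p hp); omega) hB
    rw [add_sub_cancel_right] at hV
    have hcard : (U \ V).card + V.card = U.card := Finset.card_sdiff_add_card_eq_card hVU
    have hVpos := hVne.card_pos
    have hHV : Disjoint H V := hHU.mono_right hVU
    have hFV : Disjoint F V := hFU.mono_right hVU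
    have hHcard : (H ∪ V).card = H.card + V.card := Finset.card_union_of_disjoint hHV
    have hun : H ∪ V ∪ U \ V = H ∪ U := by
      rw [Finset.union_assoc, Finset.union_sdiff_of_subset hVU]
    have IH := ih _ (by omega) F (H ∪ V) (U \ V) rfl
      (Finset.disjoint_union_right.2 ⟨hFH, hFV⟩) (hFU.mono_right Finset.sdiff_subset)
      (Finset.disjoint_union_left.2 ⟨hHU.mono_right Finset.sdiff_subset, Finset.disjoint_sdiff⟩)
      (by rw [Finset.union_assoc, hun, ← Finset.union_assoc, hQ])
      (by rw [← Finset.union_assoc]; exact Finset.mem_union_left _ h5F)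
    rw [hun, Finset.prod_union hHV, ← mul_assoc, ← hA] at IH
    refine IH.trans ?_
    have hVprod : 0 < ∏ p ∈ V, (p : ℝ) :=
      Finset.prod_pos fun p hp => by linarith [hp5 p (hUQ p (hVU hp))]
    have hlog : Real.log (A * ∏ p ∈ V, (p : ℝ) + 1) ≤ 2 ^ V.card * Real.log (A + 1) := by
      have := Real.log_le_log (by positivity) hV
      rwa [Real.log_pow, Nat.cast_pow, Nat.cast_ofNat] at this
    have hcpos : 0 ≤ ∏ p ∈ H ∪ U, c p := Finset.prod_nonneg fun p hp =>
      hc p (by rcases Finset.mem_union.1 hp with h | h <;> [exact hHQ p h; exact hUQ p h])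
    calc _ ≤ 2 ^ (U \ V).card * (∏ p ∈ H ∪ U, c p) * (2 ^ V.card * Real.log (A + 1)) := by gcongr
      _ = _ := by rw [← hcard, pow_add]; ring
  · have hHe : H = ∅ := by
      by_contra hne
      have hne : H.Nonempty := Finset.nonempty_iff_ne_empty.2 hne
      set q := H.max' hne
      have hqH : q ∈ H := Finset.max'_mem _ _
      have hq := hprime q (hHQ q hqH)
      have hqD : q ∣ D := hEq ▸ Dvd.dvd.mul_left (Finset.dvd_prod_of_mem (fun p => p) hqH) _
      rw [hD, hq.dvd_mul, hq.dvd_mul] at hqD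
      rcases hqD with (h | h) | h
      · have h3 : q ∣ 3 := hq.dvd_of_dvd_pow (n := 2) (by norm_num; exact h)
        have := Nat.le_of_dvd (by norm_num) h3
        have := h5 q (hHQ q hqH)
        omega
      · obtain ⟨p, hpF, hqp⟩ := (hq.prime.dvd_finsetProd_iff _).1 h
        have := (Nat.prime_dvd_prime_iff_eq hq (hprime p (hFQ p hpF))).1 (hq.dvd_of_dvd_pow hqp)
        exact Finset.disjoint_left.1 hFH hpF (this ▸ hqH)
      · obtain ⟨p, hpH, hqp⟩ := (hq.prime.dvd_finsetProd_iff _).1 h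
        have h1 := h5 p (hHQ p hpH)
        have h2 := Nat.le_of_dvd (by omega) hqp
        have h3 : p ≤ q := Finset.le_max' _ _ hpH
        omega
    have hUe : U = ∅ := by
      by_contra hne
      have h := Finset.prod_lt_prod_of_nonempty (s := U) (f := fun _ => (1 : ℝ))
        (g := fun p => (S p : ℝ) / p ^ e p) (fun _ _ => zero_lt_one) hUlt
        (Finset.nonempty_iff_ne_empty.2 hne)
      rw [Finset.prod_const_one] at h
      rw [← hEq, hnumA, hHe, Finset.prod_empty, mul_one] at hident
      nlinarith
    subst hHe hUe
    simp only [Finset.union_empty] at hQ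
    simp [hA, hQ]
  · have hgtR : (D : ℝ) + 1 ≤ A := by rw [← hnumA]; exact_mod_cast hgt
    have hsum : 1 / A ≤ ∑ p ∈ H, 1 / (p : ℝ) ^ (e p + 1) := by
      have h1 := one_sub_sum_le_prod_one_sub H (fun p => 1 / (p : ℝ) ^ (e p + 1))
        (fun p _ => by positivity) hHle
      have h2 : A * ∏ p ∈ H, (1 - 1 / (p : ℝ) ^ (e p + 1)) ≤ D := by
        rw [← hident]
        exact le_mul_of_one_le_right (by positivity) hU1
      rw [div_le_iff₀ hApos]
      nlinarith
    obtain ⟨p, hpH, hp⟩ := hstep F H hFH (hQ ▸ Finset.subset_union_left) h5F hsum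
    have hpF : p ∉ F := fun h => Finset.disjoint_left.1 hFH h hpH
    have hpU : p ∉ U := Finset.disjoint_left.1 hHU hpH
    have hcard := Finset.card_erase_add_one hpH
    have hun : insert p F ∪ H.erase p = F ∪ H := by
      rw [Finset.insert_union, ← Finset.union_insert, Finset.insert_erase hpH]
    have IH := ih _ (by omega) (insert p F) (H.erase p) U rfl
      (Finset.disjoint_insert_left.2
        ⟨Finset.notMem_erase _ _, hFH.mono_right (Finset.erase_subset _ _)⟩)
      (Finset.disjoint_insert_left.2 ⟨hpU, hFU⟩) (hHU.mono_left (Finset.erase_subset _ _))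
      (by rw [hun, hQ]) (by rw [hun]; exact h5F)
    have hp0 : (0 : ℝ) < p := by linarith [hp5 p (hHQ p hpH)]
    have hA' : 5 * (∏ p ∈ insert p F, (S p : ℝ)) * (∏ p ∈ H.erase p, (p : ℝ)) = A * (S p / p) := by
      rw [hA, Finset.prod_insert hpF, ← Finset.mul_prod_erase H _ hpH]
      field_simp
    rw [hA'] at IH
    refine IH.trans ?_
    have hcU : ∏ p ∈ H ∪ U, c p = c p * ∏ p ∈ H.erase p ∪ U, c p := by
      rw [← Finset.mul_prod_erase (H ∪ U) _ (Finset.mem_union_left _ hpH),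
        Finset.erase_union_distrib, Finset.erase_eq_of_notMem hpU]
    have hcpos : 0 ≤ ∏ p ∈ H.erase p ∪ U, c p := Finset.prod_nonneg fun p hp =>
      hc p (by
        rcases Finset.mem_union.1 hp with h | h
        · exact hHQ p (Finset.mem_of_mem_erase h)
        · exact hUQ p h)
    calc _ ≤ 2 ^ U.card * (∏ p ∈ H.erase p ∪ U, c p) * (c p * Real.log (A + 1)) := by gcongr
      _ = _ := by rw [hcU]; ring

lemma exists_weight_mul_le {H : Finset ℕ} {x w : ℕ → ℝ} {A : ℝ} (hA : 0 < A)
    (hx : ∀ p ∈ H, 0 < x p) (hsum : 1 / A ≤ ∑ p ∈ H, 1 / x p) (hw : ∑ p ∈ H, w p ≤ 1) :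
    ∃ p ∈ H, w p * x p ≤ A := by
  have hne : H.Nonempty := by
    by_contra h
    rw [Finset.not_nonempty_iff_eq_empty.1 h, Finset.sum_empty] at hsum
    exact absurd (one_div_pos.2 hA) (not_lt.2 hsum)
  have h : ∑ p ∈ H, w p / A ≤ ∑ p ∈ H, 1 / x p := by
    rw [← Finset.sum_div]
    exact (by gcongr : _ ≤ 1 / A).trans hsum
  obtain ⟨p, hp, hle⟩ := Finset.exists_le_of_sum_le hne h
  refine ⟨p, hp, ?_⟩
  rwa [div_le_div_iff₀ hA (hx p hp), one_mul] at hle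

lemma sum_one_div_mul_pred_le (H : Finset ℕ) (hH : ∀ p ∈ H, 2 ≤ p) (M : ℝ) (hM1 : 1 ≤ M)
    (hM : ∀ p ∈ H, (p : ℝ) ≤ M) : ∑ p ∈ H, 1 / ((p : ℝ) * (p - 1)) ≤ 1 - 1 / M := by
  induction H using Finset.induction_on_max generalizing M with
  | empty =>
    have : 1 / M ≤ 1 := by rw [div_le_one (by linarith)]; exact hM1
    simpa using this
  | insert a H ha ih =>
    have haH : a ∉ H := fun h => lt_irrefl _ (ha a h)
    have ha2 : (2 : ℝ) ≤ a := by exact_mod_cast hH a (by simp)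
    have IH := ih (fun p hp => hH p (by simp [hp])) ((a : ℝ) - 1) (by linarith) (fun p hp => by
      have : (p : ℝ) + 1 ≤ a := by exact_mod_cast ha p hp
      linarith)
    have ha1 : (0 : ℝ) < a - 1 := by linarith
    have h1 : 1 / M ≤ 1 / (a : ℝ) := one_div_le_one_div_of_le (by linarith) (hM a (by simp))
    have h2 : 1 / ((a : ℝ) * (a - 1)) = 1 / (a - 1) - 1 / a := by field_simp; ring
    rw [Finset.sum_insert haH, h2]
    linarith

lemma exists_log_le_two_mul {H : Finset ℕ} {e S : ℕ → ℕ} {A : ℝ} (hA : 0 < A)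
    (h5 : ∀ p ∈ H, 5 ≤ p) (hS : ∀ p ∈ H, (S p : ℝ) * (p - 1) = p ^ (e p + 1) - 1)
    (hsum : 1 / A ≤ ∑ p ∈ H, 1 / (p : ℝ) ^ (e p + 1)) :
    ∃ p ∈ H, Real.log (A * (S p / p) + 1) ≤ 2 * Real.log (A + 1) := by
  have hw : ∑ p ∈ H, 1 / ((p : ℝ) * (p - 1)) ≤ 1 := by
    have h0 : 0 ≤ ∑ p ∈ H, (p : ℝ) := by positivity
    refine (sum_one_div_mul_pred_le H (fun p hp => by have := h5 p hp; omega)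
      (1 + ∑ p ∈ H, (p : ℝ)) (by linarith) fun p hp => ?_).trans ?_
    · have := Finset.single_le_sum (f := fun x : ℕ => (x : ℝ)) (fun i _ => by positivity) hp
      linarith
    · have : 0 ≤ 1 / (1 + ∑ p ∈ H, (p : ℝ)) := by positivity
      linarith
  have hp5 : ∀ p ∈ H, (5 : ℝ) ≤ p := fun p hp => by exact_mod_cast h5 p hp
  obtain ⟨p, hp, hle⟩ := exists_weight_mul_le hA
    (fun p hp => pow_pos (by linarith [hp5 p hp]) _) hsum hw
  refine ⟨p, hp, ?_⟩
  have hp0 := hp5 p hp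
  have hp1 : (0 : ℝ) < p - 1 := by linarith
  have hs := hS p hp
  have hle' : (S p : ℝ) / p ≤ A := by
    refine le_trans ?_ hle
    rw [one_div_mul_eq_div, div_le_div_iff₀ (by positivity) (by positivity)]
    calc (S p : ℝ) * (p * (p - 1)) = (p ^ (e p + 1) - 1) * p := by rw [← hs]; ring
      _ ≤ _ := by gcongr; linarith
  have h2 : A * (S p / p) + 1 ≤ (A + 1) ^ 2 := by nlinarith
  calc _ ≤ Real.log ((A + 1) ^ 2) := Real.log_le_log (by positivity) h2
    _ = _ := by rw [Real.log_pow]; norm_num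

lemma prod_add_seven_le_prod (H : Finset ℕ) (hH : ∀ p ∈ H, 7 ≤ p) :
    ∏ i ∈ Finset.range H.card, (7 + i) ≤ ∏ p ∈ H, p := by
  induction H using Finset.induction_on_max with
  | empty => simp
  | insert a H ha ih =>
    have haH : a ∉ H := fun h => lt_irrefl _ (ha a h)
    have hsub : H ⊆ Finset.Ico 7 a := fun p hp =>
      Finset.mem_Ico.2 ⟨hH p (by simp [hp]), ha p hp⟩
    have hcard := Finset.card_le_card hsub
    have ha7 := hH a (by simp)
    rw [Nat.card_Ico] at hcard
    rw [Finset.card_insert_of_notMem haH, Finset.prod_range_succ, Finset.prod_insert haH, mul_comm]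
    exact Nat.mul_le_mul (by omega) (ih fun p hp => hH p (by simp [hp]))

lemma pow_six_le_prod_add_seven (h : ℕ) :
    44 * h ^ 6 ≤ 125 * ∏ i ∈ Finset.range h, (7 + i) := by
  rcases lt_or_ge h 3 with hlt | hge
  · interval_cases h <;> simp [Finset.prod_range_succ]
  · induction h, hge using Nat.le_induction with
    | base => simp [Finset.prod_range_succ]
    | succ h hge ih =>
      rw [Finset.prod_range_succ]
      have h1 : (3 * (h + 1)) ^ 6 ≤ (4 * h) ^ 6 := Nat.pow_le_pow_left (by omega) 6
      rw [mul_pow, mul_pow] at h1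
      calc 44 * (h + 1) ^ 6 ≤ 44 * h ^ 6 * 10 := by omega
        _ ≤ 125 * (∏ i ∈ Finset.range h, (7 + i)) * (7 + h) := Nat.mul_le_mul ih (by omega)
        _ = _ := mul_assoc _ _ _

lemma exists_log_le_of_exponent_le {H : Finset ℕ} {e S : ℕ → ℕ} {A : ℝ}
    (hA : 25 * ∏ p ∈ H.erase 5, (p : ℝ) ≤ A) (h7 : ∀ p ∈ H, p ≠ 5 → 7 ≤ p)
    (he1 : ∀ p ∈ H, p ≠ 5 → 1 ≤ e p) (he : ∀ p ∈ H, p ≠ 5 → e p ≤ 4)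
    (hS : ∀ p ∈ H, (S p : ℝ) * (p - 1) = p ^ (e p + 1) - 1)
    (hsum : 1 / A ≤ ∑ p ∈ H, 1 / (p : ℝ) ^ (e p + 1)) :
    ∃ p ∈ H, Real.log (A * (S p / p) + 1) ≤
      (if p = 5 then 2 else 17 / 10) * Real.log (A + 1) := by
  have hA0 : 0 < A := by
    refine lt_of_lt_of_le ?_ hA
    have : 0 < ∏ p ∈ H.erase 5, (p : ℝ) := Finset.prod_pos fun p hp => by
      have := h7 p (Finset.mem_of_mem_erase hp) (Finset.ne_of_mem_erase hp)
      positivity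
    positivity
  have hppos : ∀ p ∈ H, (5 : ℝ) ≤ p := fun p hp => by
    by_cases h : p = 5
    · simp [h]
    · have := h7 p hp h
      have : 5 ≤ p := by omega
      exact_mod_cast this
  set h := (H.erase 5).card with hh
  have hAh : 44 * (h : ℝ) ^ 6 ≤ 5 * A := by
    have h1 := (pow_six_le_prod_add_seven h).trans (Nat.mul_le_mul_left 125
      (prod_add_seven_le_prod (H.erase 5) fun p hp =>
        h7 p (Finset.mem_of_mem_erase hp) (Finset.ne_of_mem_erase hp)))
    have h2 : 44 * (h : ℝ) ^ 6 ≤ 125 * ∏ p ∈ H.erase 5, (p : ℝ) := by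
      have := (Nat.cast_le (α := ℝ)).2 h1
      push_cast at this
      exact this
    linarith
  have hw : ∑ p ∈ H, (if p = 5 then 1 / 10 else 9 / (10 * (h : ℝ))) ≤ 1 := by
    have h1 : ∑ p ∈ H.erase 5, (if p = 5 then 1 / 10 else 9 / (10 * (h : ℝ))) ≤ 9 / 10 := by
      rw [Finset.sum_congr rfl (fun p hp => if_neg (Finset.ne_of_mem_erase hp)),
        Finset.sum_const, ← hh, nsmul_eq_mul]
      rcases Nat.eq_zero_or_pos h with h0 | h0
      · rw [h0]; norm_num
      · exact le_of_eq (by field_simp)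
    by_cases h5 : 5 ∈ H
    · rw [← Finset.add_sum_erase _ _ h5, if_pos rfl]
      linarith
    · rw [Finset.erase_eq_of_notMem h5] at h1
      linarith
  obtain ⟨p, hp, hle⟩ := exists_weight_mul_le hA0
    (fun p hp => pow_pos (by linarith [hppos p hp]) _) hsum hw
  refine ⟨p, hp, ?_⟩
  have hs := hS p hp
  by_cases hp5 : p = 5
  · subst hp5
    simp only [if_true] at hle ⊢
    push_cast at hs hle ⊢
    have h2 : A * (S 5 / 5) + 1 ≤ (A + 1) ^ 2 := by nlinarith
    calc _ ≤ Real.log ((A + 1) ^ 2) := Real.log_le_log (by positivity) h2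
      _ = _ := by rw [Real.log_pow]; norm_num
  · rw [if_neg hp5] at hle ⊢
    have hp7 : (7 : ℝ) ≤ p := by exact_mod_cast h7 p hp hp5
    have hh0 : (0 : ℝ) < h := by
      have : 0 < h := Finset.card_pos.2 ⟨p, Finset.mem_erase.2 ⟨hp5, hp⟩⟩
      exact_mod_cast this
    obtain ⟨k, hk⟩ : ∃ k, e p = k + 1 := ⟨e p - 1, by have := he1 p hp hp5; omega⟩
    have hk3 : k ≤ 3 := by have := he p hp hp5; omega
    rw [hk] at hs hle
    have hle' : (p : ℝ) ^ (k + 1 + 1) ≤ 10 / 9 * h * A := by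
      rw [div_mul_eq_mul_div, div_le_iff₀ (by positivity)] at hle
      linarith
    have hp1 : (0 : ℝ) < p - 1 := by linarith
    have hpk : (1 : ℝ) ≤ p ^ k := one_le_pow₀ (by linarith)
    have hy1 : 1 ≤ (S p : ℝ) / p := by
      rw [one_le_div (by linarith)]
      refine le_of_mul_le_mul_right ?_ hp1
      rw [hs, pow_succ, pow_succ]
      have : 1 * (p * p : ℝ) ≤ p ^ k * (p * p) := by gcongr
      linarith
    have hy2 : (S p : ℝ) / p ≤ 7 / 6 * p ^ k := by
      rw [div_le_iff₀ (by linarith)]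
      refine le_of_mul_le_mul_right ?_ hp1
      rw [hs, pow_succ, pow_succ]
      nlinarith [mul_nonneg (mul_nonneg (by linarith : (0 : ℝ) ≤ p ^ k)
        (by linarith : (0 : ℝ) ≤ p)) (by linarith : (0 : ℝ) ≤ p - 7)]
    have hy3 : ((S p : ℝ) / p) ^ 10 ≤ (A + 1) ^ 7 := by
      calc ((S p : ℝ) / p) ^ 10 ≤ (7 / 6 * p ^ k) ^ 10 := by gcongr
        _ = (7 / 6) ^ 10 * (p : ℝ) ^ (k * 10) := by rw [mul_pow, ← pow_mul]
        _ ≤ (7 / 6) ^ 10 * (p : ℝ) ^ ((k + 1 + 1) * 6) := by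
          gcongr 1
          exact pow_le_pow_right₀ (by linarith) (by omega)
        _ = (7 / 6) ^ 10 * ((p : ℝ) ^ (k + 1 + 1)) ^ 6 := by rw [← pow_mul]
        _ ≤ (7 / 6) ^ 10 * (10 / 9 * h * A) ^ 6 := by gcongr
        _ = (7 / 6) ^ 10 * (10 / 9) ^ 6 * h ^ 6 * A ^ 6 := by ring
        _ ≤ A * A ^ 6 := by
          gcongr
          nlinarith [pow_pos hh0 6]
        _ = A ^ 7 := by ring
        _ ≤ (A + 1) ^ 7 := by gcongr; linarith
    have hlog := Real.log_le_log (by positivity) hy3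
    rw [Real.log_pow, Real.log_pow] at hlog
    push_cast at hlog
    have h2 : A * (S p / p) + 1 ≤ (A + 1) * (S p / p) := by linarith
    calc _ ≤ Real.log ((A + 1) * (S p / p)) := Real.log_le_log (by positivity) h2
      _ = Real.log (A + 1) + Real.log (S p / p) := Real.log_mul (by positivity) (by positivity)
      _ ≤ _ := by linarith

lemma prod_div_pred_lt_of_card_eq_three {U : Finset ℕ} (hprime : ∀ p ∈ U, p.Prime)
    (h7 : ∀ p ∈ U, 7 ≤ p) (hU : U.card = 3) :
    ∏ p ∈ U, ((p : ℝ) / (p - 1)) < 36 / 25 := by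
  have hcases : ∀ p ∈ U, 0 < (p : ℝ) / (p - 1) ∧
      (p = 7 ∧ (p : ℝ) / (p - 1) = 7 / 6 ∨ p = 11 ∧ (p : ℝ) / (p - 1) = 11 / 10 ∨
        (p : ℝ) / (p - 1) ≤ 13 / 12) := fun p hp => by
    have hp7 := h7 p hp
    have hp7' : (7 : ℝ) ≤ p := by exact_mod_cast hp7
    refine ⟨div_pos (by linarith) (by linarith), ?_⟩
    rcases lt_or_ge p 13 with h | h
    · have := hprime p hp
      interval_cases p <;> first | (norm_num; done) | (norm_num at this)
    · have h' : (13 : ℝ) ≤ p := by exact_mod_cast h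
      right; right
      rw [div_le_div_iff₀ (by linarith) (by norm_num)]
      linarith
  obtain ⟨x, y, z, hxy, hxz, hyz, rfl⟩ := Finset.card_eq_three.1 hU
  obtain ⟨hx0, hx⟩ := hcases x (by simp)
  obtain ⟨hy0, hy⟩ := hcases y (by simp)
  obtain ⟨hz0, hz⟩ := hcases z (by simp)
  rw [Finset.prod_insert (by simp [hxy, hxz]), Finset.prod_insert (by simpa using hyz),
    Finset.prod_singleton]
  have key : ∀ u v w a b c : ℝ, 0 < u → 0 < v → 0 < w → u ≤ a → v ≤ b → w ≤ c →
      a * (b * c) < 36 / 25 → u * (v * w) < 36 / 25 := fun u v w a b c hu hv hw h1 h2 h3 h =>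
    lt_of_le_of_lt (mul_le_mul h1 (mul_le_mul h2 h3 hw.le (hv.le.trans h2)) (mul_pos hv hw).le
      (hu.le.trans h1)) h
  rcases hx with ⟨hx, hx'⟩ | ⟨hx, hx'⟩ | hx' <;> rcases hy with ⟨hy, hy'⟩ | ⟨hy, hy'⟩ | hy' <;>
    rcases hz with ⟨hz, hz'⟩ | ⟨hz, hz'⟩ | hz' <;>
    first
      | omega
      | exact key _ _ _ _ _ _ hx0 hy0 hz0 (le_of_eq hx') (le_of_eq hy') hz' (by norm_num)
      | exact key _ _ _ _ _ _ hx0 hy0 hz0 (le_of_eq hx') hy' (le_of_eq hz') (by norm_num)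
      | exact key _ _ _ _ _ _ hx0 hy0 hz0 hx' (le_of_eq hy') (le_of_eq hz') (by norm_num)
      | exact key _ _ _ _ _ _ hx0 hy0 hz0 (le_of_eq hx') hy' hz' (by norm_num)
      | exact key _ _ _ _ _ _ hx0 hy0 hz0 hx' (le_of_eq hy') hz' (by norm_num)
      | exact key _ _ _ _ _ _ hx0 hy0 hz0 hx' hy' (le_of_eq hz') (by norm_num)
      | exact key _ _ _ _ _ _ hx0 hy0 hz0 hx' hy' hz' (by norm_num)

/-- The bound obtained once the inequality `∏ p / (p - 1) ≥ 36 / 25` over the primes other than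
`5` has been used to find the first few of them. -/
lemma exists_first_primes {U : Finset ℕ} (h7 : ∀ p ∈ U, 7 ≤ p)
    (hU : 36 / 25 ≤ ∏ p ∈ U, ((p : ℝ) / (p - 1))) :
    ∃ V ⊆ U, 3 ≤ V.card ∧
      Real.log (25 * ∏ p ∈ V, (p : ℝ) + 1) ≤ 2 ^ V.card * (5 / 6 * Real.log 6) := by
  obtain ⟨V, hVU, hVne, hV⟩ := exists_subset_prod_le (B := 36 / 11) (by norm_num) U
    (fun p hp => by have := h7 p hp; omega) (by norm_num at hU ⊢; exact hU)
  have hlow := prod_add_seven_le_prod V fun p hp => h7 p (hVU hp)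
  have hlow' : ((∏ i ∈ Finset.range V.card, (7 + i) : ℕ) : ℝ) ≤ ∏ p ∈ V, (p : ℝ) := by
    rw [← Nat.cast_prod]
    exact Nat.cast_le.2 hlow
  have hcard : 3 ≤ V.card := by
    by_contra! hlt
    have := hVne.card_pos
    interval_cases hc : V.card <;> norm_num [Finset.prod_range_succ] at hlow' hV <;> linarith
  refine ⟨V, hVU, hcard, ?_⟩
  have hpos : 0 < ∏ p ∈ V, (p : ℝ) := Finset.prod_pos fun p hp => by
    have := h7 p (hVU hp)
    positivity
  set n := 2 ^ V.card with hn
  have hn8 : 8 ≤ n := (Nat.pow_le_pow_right (by norm_num) hcard : 2 ^ 3 ≤ n)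
  have h1 : 25 * ∏ p ∈ V, (p : ℝ) + 1 ≤ 11 * (36 / 11) ^ n := by linarith
  have h2 : (25 * ∏ p ∈ V, (p : ℝ) + 1) ^ 6 ≤ 6 ^ (5 * n) := by
    calc (25 * ∏ p ∈ V, (p : ℝ) + 1) ^ 6 ≤ (11 * (36 / 11) ^ n) ^ 6 := by gcongr
      _ = 11 ^ 6 * ((36 / 11) ^ 6) ^ n := by rw [mul_pow, ← pow_mul, ← pow_mul, mul_comm n]
      _ ≤ ((6 ^ 5 : ℝ) / (36 / 11) ^ 6) ^ 8 * ((36 / 11) ^ 6) ^ n := by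
        gcongr
        norm_num
      _ ≤ ((6 ^ 5 : ℝ) / (36 / 11) ^ 6) ^ n * ((36 / 11) ^ 6) ^ n := by
        gcongr
        norm_num
      _ = 6 ^ (5 * n) := by
        rw [← mul_pow, div_mul_cancel₀ _ (by positivity), pow_mul]
  have h3 := Real.log_le_log (by positivity) h2
  rw [Real.log_pow, Real.log_pow] at h3
  have h4 : (n : ℝ) = 2 ^ V.card := by rw [hn]; push_cast; rfl
  push_cast at h3
  rw [← h4]
  linarith

lemma four_le_card_and_log_prod_le {Q : Finset ℕ} {e S : ℕ → ℕ} {κ : ℝ}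
    (hprime : ∀ p ∈ Q, p.Prime) (h5Q : 5 ∈ Q) (h7 : ∀ p ∈ Q, p ≠ 5 → 7 ≤ p)
    (he : ∀ p ∈ Q, 1 ≤ e p) (hS : ∀ p ∈ Q, (S p : ℝ) * (p - 1) = p ^ (e p + 1) - 1)
    (heq : 5 * ∏ p ∈ Q, S p = 9 * ∏ p ∈ Q, p ^ e p) (hκ : 0 ≤ κ)
    (hstep : ∀ H ⊆ Q, ∀ A : ℝ, 25 * ∏ p ∈ H.erase 5, (p : ℝ) ≤ A →
      1 / A ≤ ∑ p ∈ H, 1 / (p : ℝ) ^ (e p + 1) →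
      ∃ p ∈ H, Real.log (A * (S p / p) + 1) ≤
        (if p = 5 then 2 else κ) * Real.log (A + 1)) :
    4 ≤ (Q.erase 5).card ∧ Real.log (9 * (∏ p ∈ Q, (p : ℝ) ^ e p) + 1) ≤
      2 * (2 * κ) ^ (Q.erase 5).card * (5 / 6 * Real.log 6) := by
  have h5 : ∀ p ∈ Q, 5 ≤ p := fun p hp => by
    by_cases h : p = 5
    · exact h.ge
    · have := h7 p hp h; omega
  have hp5 : ∀ p ∈ Q, (5 : ℝ) ≤ p := fun p hp => by exact_mod_cast h5 p hp
  have hU7 : ∀ p ∈ Q.erase 5, 7 ≤ p := fun p hp =>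
    h7 p (Finset.mem_of_mem_erase hp) (Finset.ne_of_mem_erase hp)
  have hSp : ∀ p ∈ Q, (p : ℝ) ≤ S p := fun p hp => by
    have h := hS p hp
    have h1 := hp5 p hp
    have h2 : (p : ℝ) ^ 2 ≤ p ^ (e p + 1) :=
      pow_le_pow_right₀ (by linarith) (by have := he p hp; omega)
    nlinarith
  have heqR : 5 * (∏ p ∈ Q, (S p : ℝ)) = 9 * ∏ p ∈ Q, (p : ℝ) ^ e p := by exact_mod_cast heq
  have hU : 36 / 25 ≤ ∏ p ∈ Q.erase 5, ((p : ℝ) / (p - 1)) := by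
    have h1 : ∏ p ∈ Q.erase 5, ((S p : ℝ) / p ^ e p) ≤ ∏ p ∈ Q.erase 5, ((p : ℝ) / (p - 1)) := by
      refine Finset.prod_le_prod (fun p _ => by positivity) fun p hp => ?_
      have hpQ := Finset.mem_of_mem_erase hp
      have h1 := hp5 p hpQ
      rw [div_le_div_iff₀ (by positivity) (by linarith), hS p hpQ, pow_succ]
      linarith
    refine le_trans ?_ h1
    have hden : 0 < ∏ p ∈ Q.erase 5, (p : ℝ) ^ e p := Finset.prod_pos fun p hp =>
      pow_pos (by linarith [hp5 p (Finset.mem_of_mem_erase hp)]) _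
    have hnum : 0 < ∏ p ∈ Q.erase 5, (S p : ℝ) := Finset.prod_pos fun p hp => by
      have hpQ := Finset.mem_of_mem_erase hp
      linarith [hp5 p hpQ, hSp p hpQ]
    have hS5 := hS 5 h5Q
    rw [← Finset.mul_prod_erase _ _ h5Q, ← Finset.mul_prod_erase _ _ h5Q] at heqR
    push_cast at hS5 heqR
    rw [Finset.prod_div_distrib, le_div_iff₀ hden]
    have h55 : (0 : ℝ) < 5 ^ e 5 := by positivity
    have hS5' : (S 5 : ℝ) ≤ 5 / 4 * 5 ^ e 5 := by rw [pow_succ] at hS5; linarith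
    refine le_of_mul_le_mul_left ?_ h55
    nlinarith [mul_le_mul_of_nonneg_right hS5' hnum.le]
  obtain ⟨V, hVU, hV3, hV⟩ := exists_first_primes hU7 hU
  have hcardle := Finset.card_le_card hVU
  refine ⟨?_, ?_⟩
  · by_contra! hlt
    exact absurd hU (not_le.2 (prod_div_pred_lt_of_card_eq_three
      (fun p hp => hprime p (Finset.mem_of_mem_erase hp)) hU7 (by omega)))
  · have h5V : 5 ∉ V := fun h => Finset.notMem_erase 5 Q (hVU h)
    have hun : insert 5 V ∪ Q.erase 5 \ V = Q := by
      rw [Finset.insert_union, Finset.union_sdiff_of_subset hVU, Finset.insert_erase h5Q]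
    have hmain := log_prod_le_of_partial (c := fun p => if p = 5 then 2 else κ) hprime h5 he hS heq
      (fun p _ => by split_ifs <;> linarith)
      (fun F H hFH hsub h5FH hsum => by
        refine hstep H (Finset.subset_union_right.trans hsub) _ ?_ hsum
        have hHpos : ∀ p ∈ H, (0 : ℝ) < p := fun p hp => by
          linarith [hp5 p (hsub (Finset.mem_union_right _ hp))]
        have hF1 : ∀ p ∈ F, (1 : ℝ) ≤ S p := fun p hp => by
          have hpQ := hsub (Finset.mem_union_left _ hp)
          linarith [hp5 p hpQ, hSp p hpQ]
        have hprod : ∀ F' ⊆ F, 1 ≤ ∏ p ∈ F', (S p : ℝ) := fun F' hF' => by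
          have := Finset.prod_le_prod (s := F') (f := fun _ => (1 : ℝ))
            (g := fun p => (S p : ℝ)) (fun _ _ => zero_le_one) (fun p hp => hF1 p (hF' hp))
          simpa using this
        have herase : 0 < ∏ p ∈ H.erase 5, (p : ℝ) :=
          Finset.prod_pos fun p hp => hHpos p (Finset.mem_of_mem_erase hp)
        rcases Finset.mem_union.1 h5FH with h | h
        · have h5H : 5 ∉ H := Finset.disjoint_left.1 hFH h
          rw [Finset.erase_eq_of_notMem h5H] at herase ⊢
          rw [← Finset.mul_prod_erase _ _ h]
          have h1 := hprod _ (Finset.erase_subset 5 F)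
          have h2 := hSp 5 h5Q
          push_cast at h2
          gcongr
          nlinarith
        · rw [← Finset.mul_prod_erase H _ h]
          have h1 := hprod F subset_rfl
          push_cast
          nlinarith)
      _ ∅ (insert 5 V) (Q.erase 5 \ V) rfl (Finset.disjoint_empty_left _)
      (Finset.disjoint_empty_left _)
      (Finset.disjoint_insert_left.2 ⟨by simp, Finset.disjoint_sdiff⟩)
      (by rw [Finset.empty_union, hun]) (by simp)
    have hcprod : ∏ p ∈ Q, (if p = 5 then (2 : ℝ) else κ) = 2 * κ ^ (Q.erase 5).card := by
      rw [← Finset.mul_prod_erase Q _ h5Q, if_pos rfl,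
        Finset.prod_congr rfl (fun p hp => if_neg (Finset.ne_of_mem_erase hp)), Finset.prod_const]
    rw [hun, Finset.prod_insert h5V, hcprod, Finset.prod_empty, heqR] at hmain
    have hcard : (Q.erase 5 \ V).card + V.card = (Q.erase 5).card :=
      Finset.card_sdiff_add_card_eq_card hVU
    have h25 : 5 * 1 * (((5 : ℕ) : ℝ) * ∏ p ∈ V, (p : ℝ)) = 25 * ∏ p ∈ V, (p : ℝ) := by
      push_cast; ring
    rw [h25] at hmain
    refine hmain.trans ?_
    calc _ ≤ 2 ^ (Q.erase 5 \ V).card * (2 * κ ^ (Q.erase 5).card) *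
          (2 ^ V.card * (5 / 6 * Real.log 6)) := by gcongr
      _ = 2 * (2 ^ ((Q.erase 5 \ V).card + V.card) * κ ^ (Q.erase 5).card) *
          (5 / 6 * Real.log 6) := by rw [pow_add]; ring
      _ = _ := by rw [hcard, mul_pow]

open ArithmeticFunction in
lemma sigma_one_mul_le_of_dvd {d n : ℕ} (hd : d ∣ n) (hn : n ≠ 0) :
    sigma 1 d * n ≤ sigma 1 n * d := by
  obtain ⟨k, rfl⟩ := hd
  have hk : k ≠ 0 := right_ne_zero_of_mul hn
  have h : sigma 1 d * k ≤ sigma 1 (d * k) := by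
    rw [sigma_one_apply, sigma_one_apply, Finset.sum_mul,
      ← Finset.sum_image (f := fun x => x) (g := fun x => x * k)
        fun x _ y _ hxy => Nat.eq_of_mul_eq_mul_right (Nat.pos_of_ne_zero hk) hxy]
    refine Finset.sum_le_sum_of_subset fun x hx => ?_
    obtain ⟨y, hy, rfl⟩ := Finset.mem_image.1 hx
    exact Nat.mem_divisors.2 ⟨Nat.mul_dvd_mul_right (Nat.dvd_of_mem_divisors hy) k, hn⟩
  calc sigma 1 d * (d * k) = sigma 1 d * k * d := by ring
    _ ≤ _ := Nat.mul_le_mul_right d h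

open ArithmeticFunction in
lemma sigma_one_prime_pow_mul_add_one {p : ℕ} (hp : p.Prime) (n : ℕ) :
    sigma 1 (p ^ n) * (p - 1) + 1 = p ^ (n + 1) := by
  rw [sigma_one_apply_prime_pow hp]
  obtain ⟨q, rfl⟩ := Nat.exists_eq_add_of_le' hp.one_le
  exact geom_sum_mul_add q (n + 1)

lemma mod_five_eq_one_of_pow_mod_five_eq_one {x k : ℕ} (h : x ^ (2 * k + 1) % 5 = 1) :
    x % 5 = 1 := by
  have h' : (x : ZMod 5) ^ (2 * k + 1) = 1 := by
    have : ((x ^ (2 * k + 1) : ℕ) : ZMod 5) = (1 : ℕ) := (ZMod.natCast_eq_natCast_iff' _ _ _).2 h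
    simpa using this
  have hx : (x : ZMod 5) = (1 : ℕ) := by
    generalize (x : ZMod 5) = y at h'
    have hy : y = 0 ∨ y ^ 4 = 1 := by
      clear h'
      revert y
      decide
    rcases hy with rfl | hy
    · exact absurd h' (by rw [zero_pow (by omega)]; decide)
    · obtain ⟨j, rfl | rfl⟩ := Nat.even_or_odd' k
      · rw [show 2 * (2 * j) + 1 = 4 * j + 1 by ring, pow_succ, pow_mul, hy, one_pow,
          one_mul] at h'
        simpa using h'
      · rw [show 2 * (2 * j + 1) + 1 = 4 * j + 3 by ring, pow_add, pow_mul, hy, one_pow,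
          one_mul] at h'
        revert y; decide
  exact (ZMod.natCast_eq_natCast_iff' _ _ _).1 hx

open ArithmeticFunction in
lemma five_pow_factorization_sigma_one_le {p k : ℕ} (hp : p.Prime) :
    5 ^ (sigma 1 (p ^ (2 * k))).factorization 5 ≤ 2 * k + 1 := by
  have hgeom := sigma_one_prime_pow_mul_add_one hp (2 * k)
  by_cases h5 : 5 ∣ sigma 1 (p ^ (2 * k))
  · have hmod : p % 5 = 1 := by
      refine mod_five_eq_one_of_pow_mod_five_eq_one (k := k) ?_
      rw [← hgeom]
      have := h5.mul_right (p - 1)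
      omega
    have : Fact (Nat.Prime 5) := ⟨by norm_num⟩
    have hp1 := hp.one_lt
    have hlte := padicValNat.pow_sub_pow (x := p) (y := 1) (p := 5) (by decide) hp1 (by omega)
      (by omega) (n := 2 * k + 1) (by omega)
    rw [one_pow, ← hgeom, Nat.add_sub_cancel, padicValNat.mul (by
      intro h; rw [h] at hgeom; have := Nat.one_lt_pow (n := 2 * k + 1) (by omega) hp1; omega)
      (by omega)] at hlte
    have hval : padicValNat 5 (sigma 1 (p ^ (2 * k))) = padicValNat 5 (2 * k + 1) := by omega
    rw [Nat.factorization_def _ (by norm_num), hval]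
    exact Nat.le_of_dvd (by omega) pow_padicValNat_dvd
  · rw [Nat.factorization_eq_zero_of_not_dvd h5]
    omega

open ArithmeticFunction in
lemma factorization_sigma_one_five_add_one_le {p k : ℕ} (hp : p.Prime) (hk : 1 ≤ k) :
    (sigma 1 (p ^ (2 * k))).factorization 5 + 1 ≤ k ∧
      (k ≤ (sigma 1 (p ^ (2 * k))).factorization 5 + 1 → k ≤ 2) := by
  have h := five_pow_factorization_sigma_one_le (k := k) hp
  generalize (sigma 1 (p ^ (2 * k))).factorization 5 = f at h
  rcases f with _ | _ | f
  · omega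
  · omega
  · have h2 : f < 5 ^ f := Nat.lt_pow_self (by norm_num)
    rw [pow_add] at h
    omega

section FriendOfTen

open ArithmeticFunction

variable {a m : ℕ}

lemma not_two_dvd_of_five_mul_sigma_one_eq (ha : 0 < a) (hm : 0 < m)
    (h : 5 * sigma 1 (5 ^ (2 * a) * m ^ 2) = 9 * (5 ^ (2 * a) * m ^ 2)) : ¬ 2 ∣ m := by
  intro h2
  have hN : 5 ^ (2 * a) * m ^ 2 ≠ 0 := by positivity
  have hd : 5 * 2 ^ 2 ∣ 5 ^ (2 * a) * m ^ 2 :=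
    mul_dvd_mul (dvd_pow_self 5 (by omega)) (pow_dvd_pow_of_dvd h2 2)
  have hle := sigma_one_mul_le_of_dvd hd hN
  have hs : sigma 1 (5 * 2 ^ 2) = 42 := by decide +kernel
  rw [hs] at hle
  omega

lemma not_three_dvd_of_five_mul_sigma_one_eq (ha : 0 < a) (hm : 0 < m)
    (h : 5 * sigma 1 (5 ^ (2 * a) * m ^ 2) = 9 * (5 ^ (2 * a) * m ^ 2)) : ¬ 3 ∣ m := by
  rintro ⟨k, rfl⟩
  have hN : 5 ^ (2 * a) * (3 * k) ^ 2 ≠ 0 := by positivity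
  have h25 : 5 ^ 2 ∣ 5 ^ (2 * a) := pow_dvd_pow 5 (by omega)
  have h25s : sigma 1 (5 ^ 2) = 31 := by decide +kernel
  have h9s : sigma 1 (3 ^ 2) = 13 := by decide +kernel
  by_cases h3 : 3 ∣ k
  · have hd : 5 ^ 2 * 9 ^ 2 ∣ 5 ^ (2 * a) * (3 * k) ^ 2 :=
      mul_dvd_mul h25 (pow_dvd_pow_of_dvd (mul_dvd_mul_left 3 h3) 2)
    have hle := sigma_one_mul_le_of_dvd hd hN
    have h81s : sigma 1 (9 ^ 2) = 121 := by decide +kernel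
    rw [isMultiplicative_sigma.map_mul_of_coprime (by norm_num), h25s, h81s] at hle
    omega
  · have hcop : (3 ^ 2).Coprime (5 ^ (2 * a) * k ^ 2) :=
      Nat.Coprime.mul_right (Nat.Coprime.pow _ _ (by norm_num))
        (Nat.Coprime.pow _ _ ((Nat.Prime.coprime_iff_not_dvd Nat.prime_three).2 h3))
    have hN' : 5 ^ (2 * a) * (3 * k) ^ 2 = 3 ^ 2 * (5 ^ (2 * a) * k ^ 2) := by ring
    have h13 : 13 ∣ k := by
      have hs := h
      rw [hN', isMultiplicative_sigma.map_mul_of_coprime hcop, h9s] at hs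
      have hdvd : 13 ∣ 5 ^ (2 * a) * k ^ 2 := by omega
      have hp : Nat.Prime 13 := by norm_num
      refine hp.dvd_of_dvd_pow ((hp.dvd_mul.1 hdvd).resolve_left fun h => ?_)
      exact absurd (hp.dvd_of_dvd_pow h) (by norm_num)
    have hd : 5 ^ 2 * (3 ^ 2 * 13 ^ 2) ∣ 5 ^ (2 * a) * (3 * k) ^ 2 := by
      rw [mul_pow]
      exact mul_dvd_mul h25 (mul_dvd_mul_left _ (pow_dvd_pow_of_dvd h13 2))
    have hle := sigma_one_mul_le_of_dvd hd hN
    have h169s : sigma 1 (13 ^ 2) = 183 := by decide +kernel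
    rw [isMultiplicative_sigma.map_mul_of_coprime (by norm_num),
      isMultiplicative_sigma.map_mul_of_coprime (by norm_num), h25s, h9s, h169s] at hle
    omega

lemma seven_le_of_mem_primeFactors (ha : 0 < a) (hm : 0 < m) (h5m : ¬ 5 ∣ m)
    (h : 5 * sigma 1 (5 ^ (2 * a) * m ^ 2) = 9 * (5 ^ (2 * a) * m ^ 2)) {p : ℕ}
    (hp : p ∈ m.primeFactors) : 7 ≤ p := by
  have hpp := Nat.prime_of_mem_primeFactors hp
  have hpm := Nat.dvd_of_mem_primeFactors hp
  by_contra! hlt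
  interval_cases p
  · simp at hpm; omega
  · exact Nat.not_prime_one hpp
  · exact not_two_dvd_of_five_mul_sigma_one_eq ha hm h hpm
  · exact not_three_dvd_of_five_mul_sigma_one_eq ha hm h hpm
  · exact absurd hpp (by norm_num)
  · exact h5m hpm
  · exact absurd hpp (by norm_num)

lemma factorization_five_pow_mul_sq (hm : 0 < m) (p : ℕ) :
    (5 ^ (2 * a) * m ^ 2).factorization p =
      (if p = 5 then 2 * a else 0) + 2 * m.factorization p := by
  rw [Nat.factorization_mul (by positivity) (by positivity), Nat.Prime.factorization_pow
    (by norm_num), Nat.factorization_pow]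
  by_cases hp : p = 5 <;> simp [hp]

lemma primeFactors_five_pow_mul_sq (ha : 0 < a) (hm : 0 < m) :
    (5 ^ (2 * a) * m ^ 2).primeFactors = insert 5 m.primeFactors := by
  rw [Nat.primeFactors_mul (by positivity) (by positivity),
    Nat.primeFactors_prime_pow (by omega) (by norm_num), Nat.primeFactors_pow _ (by norm_num),
    Finset.singleton_union]

lemma sum_factorization_sigma_one_add_one (hm : 0 < m) (h5m : ¬ 5 ∣ m)
    (h : 5 * sigma 1 (5 ^ (2 * a) * m ^ 2) = 9 * (5 ^ (2 * a) * m ^ 2)) :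
    ∑ p ∈ m.primeFactors, (sigma 1 (p ^ (2 * m.factorization p))).factorization 5 + 1 =
      2 * a := by
  have hpos : ∀ n, n ≠ 0 → sigma 1 n ≠ 0 := fun n hn => (sigma_pos 1 n hn).ne'
  have hcop : (5 ^ (2 * a)).Coprime (m ^ 2) :=
    Nat.Coprime.pow _ _ ((Nat.Prime.coprime_iff_not_dvd (by norm_num)).2 h5m)
  have hm2 : sigma 1 (m ^ 2) = ∏ p ∈ m.primeFactors, sigma 1 (p ^ (2 * m.factorization p)) := by
    rw [IsMultiplicative.multiplicative_factorization _ isMultiplicative_sigma (by positivity),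
      Finsupp.prod, Nat.support_factorization, Nat.primeFactors_pow _ (by norm_num)]
    simp [Nat.factorization_pow]
  have hfive : (sigma 1 (5 ^ (2 * a))).factorization 5 = 0 := by
    refine Nat.factorization_eq_zero_of_not_dvd ?_
    have := sigma_one_prime_pow_mul_add_one (p := 5) (by norm_num) (2 * a)
    rw [pow_succ] at this
    omega
  have h' := congrArg (fun n => n.factorization 5) h
  beta_reduce at h'
  rw [isMultiplicative_sigma.map_mul_of_coprime hcop, hm2, Nat.factorization_mul (by norm_num)
    (mul_ne_zero (hpos _ (by positivity)) (Finset.prod_ne_zero_iff.2 fun p hp => hpos _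
      (pow_ne_zero _ (Nat.prime_of_mem_primeFactors hp).ne_zero))),
    Nat.factorization_mul (hpos _ (by positivity)) (Finset.prod_ne_zero_iff.2 fun p hp => hpos _
      (pow_ne_zero _ (Nat.prime_of_mem_primeFactors hp).ne_zero)),
    Nat.factorization_prod fun p hp => hpos _
      (pow_ne_zero _ (Nat.prime_of_mem_primeFactors hp).ne_zero),
    Nat.factorization_mul (by norm_num) (by positivity)] at h'
  simp only [Finsupp.add_apply, Finsupp.finsetSum_apply, hfive,
    factorization_five_pow_mul_sq hm, Nat.factorization_eq_zero_of_not_dvd h5m, if_true,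
    Nat.factorization_eq_zero_of_not_dvd (show ¬ 5 ∣ 9 by norm_num),
    Nat.Prime.factorization_self (show Nat.Prime 5 by norm_num)] at h'
  omega

/-- The power of `5` in `5 * σ N = 9 * N` bounds the number of repeated prime factors of `m`, and
in the extremal case the exponents are small. -/
lemma two_mul_add_card_primeFactors_le (hm : 0 < m) (h5m : ¬ 5 ∣ m)
    (h : 5 * sigma 1 (5 ^ (2 * a) * m ^ 2) = 9 * (5 ^ (2 * a) * m ^ 2)) :
    2 * a + m.primeFactors.card ≤ m.primeFactorsList.length ∨
      2 * a + m.primeFactors.card = m.primeFactorsList.length + 1 ∧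
        ∀ p ∈ m.primeFactors, m.factorization p ≤ 2 := by
  have hsum := sum_factorization_sigma_one_add_one hm h5m h
  have hle : ∀ p ∈ m.primeFactors,
      (sigma 1 (p ^ (2 * m.factorization p))).factorization 5 + 1 ≤ m.factorization p ∧
      (m.factorization p ≤ (sigma 1 (p ^ (2 * m.factorization p))).factorization 5 + 1 →
        m.factorization p ≤ 2) := fun p hp => by
    have hpp := Nat.prime_of_mem_primeFactors hp
    have hpm := Nat.dvd_of_mem_primeFactors hp
    exact factorization_sigma_one_five_add_one_le hpp (hpp.factorization_pos_of_dvd hm.ne' hpm)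
  have hlen : m.primeFactorsList.length = ∑ p ∈ m.primeFactors, m.factorization p := by
    rw [← cardFactors_apply, cardFactors_eq_sum_factorization, Finsupp.sum,
      Nat.support_factorization]
  have hadd := Finset.sum_add_distrib (s := m.primeFactors)
    (f := fun p => (sigma 1 (p ^ (2 * m.factorization p))).factorization 5) (g := fun _ => 1)
  rw [Finset.sum_const, smul_eq_mul, mul_one] at hadd
  by_cases hall : ∀ p ∈ m.primeFactors,
      m.factorization p ≤ (sigma 1 (p ^ (2 * m.factorization p))).factorization 5 + 1
  · right
    have : ∑ p ∈ m.primeFactors, ((sigma 1 (p ^ (2 * m.factorization p))).factorization 5 + 1) =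
        ∑ p ∈ m.primeFactors, m.factorization p :=
      Finset.sum_congr rfl fun p hp => le_antisymm (hle p hp).1 (hall p hp)
    exact ⟨by omega, fun p hp => (hle p hp).2 (hall p hp)⟩
  · left
    push Not at hall
    have := Finset.sum_lt_sum (fun p hp => (hle p hp).1) hall
    omega

end FriendOfTen

lemma lt_five_mul_six_pow_of_log_le {N n k : ℕ} {C : ℝ}
    (h : Real.log (9 * (N : ℝ) + 1) ≤ C * Real.log 6) (hC : C ≤ (2 ^ n - 1) ^ 2) (hnk : n ≤ k) :
    N < 5 * 6 ^ ((2 ^ k - 1) ^ 2) := by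
  have hcast : C ≤ (((2 ^ k - 1) ^ 2 : ℕ) : ℝ) := by
    rw [Nat.cast_pow, Nat.cast_sub Nat.one_le_two_pow]
    push_cast
    refine hC.trans ?_
    have h1 : (1 : ℝ) ≤ 2 ^ n := one_le_pow₀ (by norm_num)
    have h2 : (2 : ℝ) ^ n ≤ 2 ^ k := pow_le_pow_right₀ (by norm_num) hnk
    have h3 : (0 : ℝ) ≤ 2 ^ n - 1 := by linarith
    gcongr
  generalize (2 ^ k - 1) ^ 2 = j at hcast ⊢
  have hlog := h.trans (mul_le_mul_of_nonneg_right hcast (Real.log_nonneg (by norm_num)))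
  rw [← Real.log_pow, Real.log_le_log_iff (by positivity) (by positivity)] at hlog
  have hnat : 9 * N + 1 ≤ 6 ^ j := by exact_mod_cast hlog
  omega

lemma mul_pow_le_two_pow_sub_one_sq {t : ℕ} (ht : 4 ≤ t) :
    5 / 3 * (17 / 5 : ℝ) ^ t ≤ (2 ^ t - 1) ^ 2 := by
  induction t, ht using Nat.le_induction with
  | base => norm_num
  | succ t _ ih =>
    have h1 : (1 : ℝ) ≤ 2 ^ t := one_le_pow₀ (by norm_num)
    have h2 : (0 : ℝ) < (17 / 5) ^ t := by positivity
    rw [pow_succ (17 / 5 : ℝ), pow_succ (2 : ℝ) t]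
    nlinarith

lemma mul_four_pow_le_two_pow_succ_sub_one_sq {t : ℕ} (ht : 4 ≤ t) :
    5 / 3 * (4 : ℝ) ^ t ≤ (2 ^ (t + 1) - 1) ^ 2 := by
  have h1 : (2 : ℝ) ^ 4 ≤ 2 ^ t := pow_le_pow_right₀ (by norm_num) ht
  rw [show (4 : ℝ) = 2 ^ 2 by norm_num, ← pow_mul, mul_comm 2, pow_mul, pow_succ 2 t]
  nlinarith

/-- If `N = 5^(2a)·m²` is a friend of 10 with `a, m ≥ 1`, `5 ∤ m`, and `Ω(m) ≤ K`,
then `N < 5·6^((2^(K−2a+1) − 1)²)`. -/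
theorem friend_of_ten_upper_bound (N a m K : ℕ) (ha : 0 < a) (hm : 0 < m)
    (h5m : ¬ 5 ∣ m) (hform : N = 5 ^ (2 * a) * m ^ 2) (hN : 10 < N)
    (hfriend : 5 * (ArithmeticFunction.sigma 1) N = 9 * N)
    (hK : m.primeFactorsList.length ≤ K) :
    N < 5 * 6 ^ ((2 ^ (K - 2 * a + 1) - 1) ^ 2) := by
  have hN0 : N ≠ 0 := by omega
  set S : ℕ → ℕ := fun p => ArithmeticFunction.sigma 1 (p ^ N.factorization p)
  have hQ : N.primeFactors = insert 5 m.primeFactors := by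
    rw [hform, primeFactors_five_pow_mul_sq ha hm]
  have hfac : ∀ p, p ≠ 5 → N.factorization p = 2 * m.factorization p := fun p hp => by
    rw [hform, factorization_five_pow_mul_sq hm, if_neg hp, zero_add]
  have herase : N.primeFactors.erase 5 = m.primeFactors := by
    rw [hQ, Finset.erase_insert fun h => h5m (Nat.dvd_of_mem_primeFactors h)]
  have hmem : ∀ p ∈ N.primeFactors, p ≠ 5 → p ∈ m.primeFactors := fun p hp hp5 => by
    rw [← herase]
    exact Finset.mem_erase.2 ⟨hp5, hp⟩
  have hprime : ∀ p ∈ N.primeFactors, p.Prime := fun p hp => Nat.prime_of_mem_primeFactors hp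
  have h5Q : 5 ∈ N.primeFactors := by rw [hQ]; exact Finset.mem_insert_self _ _
  have hfriend' := hfriend
  rw [hform] at hfriend'
  have h7 : ∀ p ∈ N.primeFactors, p ≠ 5 → 7 ≤ p := fun p hp hp5 =>
    seven_le_of_mem_primeFactors ha hm h5m hfriend' (hmem p hp hp5)
  have h5 : ∀ p ∈ N.primeFactors, 5 ≤ p := fun p hp => by
    by_cases h : p = 5
    · exact h.ge
    · have := h7 p hp h; omega
  have he : ∀ p ∈ N.primeFactors, 1 ≤ N.factorization p := fun p hp =>
    (hprime p hp).factorization_pos_of_dvd hN0 (Nat.dvd_of_mem_primeFactors hp)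
  have hS : ∀ p ∈ N.primeFactors,
      (S p : ℝ) * (p - 1) = p ^ (N.factorization p + 1) - 1 := fun p hp => by
    have h := sigma_one_prime_pow_mul_add_one (hprime p hp) (N.factorization p)
    rw [eq_sub_iff_add_eq, ← Nat.cast_pred (hprime p hp).pos]
    exact_mod_cast h
  have hprod : ∏ p ∈ N.primeFactors, p ^ N.factorization p = N :=
    Nat.prod_factorization_pow_eq_self hN0
  have heq : 5 * ∏ p ∈ N.primeFactors, S p = 9 * ∏ p ∈ N.primeFactors, p ^ N.factorization p := by
    rw [hprod, ← hfriend, ArithmeticFunction.IsMultiplicative.multiplicative_factorization _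
      ArithmeticFunction.isMultiplicative_sigma hN0]
    rfl
  have hprodR : ∏ p ∈ N.primeFactors, (p : ℝ) ^ N.factorization p = N := by exact_mod_cast hprod
  rcases two_mul_add_card_primeFactors_le hm h5m hfriend' with hcard | ⟨hcard, hle⟩
  · obtain ⟨ht, hlog⟩ := four_le_card_and_log_prod_le (κ := 2) hprime h5Q h7 he hS heq
      (by norm_num) fun H hHQ A hA hsum => by
        have hpos : 0 < ∏ p ∈ H.erase 5, (p : ℝ) := Finset.prod_pos fun p hp => by
          have := h5 p (hHQ (Finset.mem_of_mem_erase hp))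
          positivity
        simp only [ite_self]
        exact exists_log_le_two_mul (by linarith) (fun p hp => h5 p (hHQ hp))
          (fun p hp => hS p (hHQ hp)) hsum
    rw [herase] at ht hlog
    rw [hprodR] at hlog
    refine lt_five_mul_six_pow_of_log_le (hlog.trans_eq ?_)
      (mul_four_pow_le_two_pow_succ_sub_one_sq ht) (by omega)
    norm_num
    ring
  · obtain ⟨ht, hlog⟩ := four_le_card_and_log_prod_le (κ := 17 / 10) hprime h5Q h7 he hS heq
      (by norm_num) fun H hHQ A hA hsum => by
        refine exists_log_le_of_exponent_le hA (fun p hp => h7 p (hHQ hp))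
          (fun p hp _ => he p (hHQ hp)) (fun p hp hp5 => ?_) (fun p hp => hS p (hHQ hp)) hsum
        have := hle p (hmem p (hHQ hp) hp5)
        rw [hfac p hp5]
        omega
    rw [herase] at ht hlog
    rw [hprodR] at hlog
    refine lt_five_mul_six_pow_of_log_le (hlog.trans_eq ?_)
      (mul_pow_le_two_pow_sub_one_sq ht) (by omega)
    norm_num
    ring
end
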